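/- arXiv:2305.16119 — 2 statements merged into one kernel-verified Lean document; each statement's English description precedes it below -/
import Mathlib

section
/- The number of pairs (D, E) of nonzero octonions in O × O such that DE = 0 and Tr(x_1·D̄) = 0 equals (q^6 − q^3 + q^4 − 1)(q^4 − 1). -/
/-!  The split octonion algebra `O` over a finite field `F` of order `q`,
represented as `Fin 8 → F` with coordinates with respect to the basis
`x_1, …, x_8` (index `i : Fin 8` corresponds to `x_{i+1}`). -/

variable {F : Type*}

/-- The split octonion multiplication, determined by the table
`x_1x_5 = x_1`, `x_1x_6 = x_2`, `x_1x_7 = −x_3`, `x_1x_8 = −x_4`, `x_2x_3 = −x_1`,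
`x_2x_4 = x_2`, `x_2x_7 = −x_5`, `x_2x_8 = x_6`, `x_3x_2 = x_1`, `x_3x_4 = x_3`,
`x_3x_6 = −x_5`, `x_3x_8 = −x_7` (the sign of `x_3x_8` is forced by `x_8x_3 = x_7` and anti-commutativity of orthogonal imaginary octonions; with it `O` is the split octonion composition algebra), `x_4x_1 = x_1`, `x_4x_4 = x_4`, `x_4x_6 = x_6`,
`x_4x_7 = x_7`, `x_5x_2 = x_2`, `x_5x_3 = x_3`, `x_5x_5 = x_5`, `x_5x_8 = x_8`,
`x_6x_1 = −x_2`, `x_6x_3 = −x_4`, `x_6x_5 = x_6`, `x_6x_7 = x_8`, `x_7x_1 = x_3`,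
`x_7x_2 = −x_4`, `x_7x_5 = x_7`, `x_7x_6 = −x_8`, `x_8x_1 = −x_5`, `x_8x_2 = −x_6`,
`x_8x_3 = x_7`, `x_8x_4 = x_8`, all other products of basis elements being `0`. -/
def octMul [Field F] (a b : Fin 8 → F) : Fin 8 → F :=
  ![a 0 * b 4 - a 1 * b 2 + a 2 * b 1 + a 3 * b 0,
    a 0 * b 5 + a 1 * b 3 + a 4 * b 1 - a 5 * b 0,
    -(a 0 * b 6) + a 2 * b 3 + a 4 * b 2 + a 6 * b 0,
    -(a 0 * b 7) + a 3 * b 3 - a 5 * b 2 - a 6 * b 1,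
    -(a 1 * b 6) - a 2 * b 5 + a 4 * b 4 - a 7 * b 0,
    a 1 * b 7 + a 3 * b 5 + a 5 * b 4 - a 7 * b 1,
    -(a 2 * b 7) + a 3 * b 6 + a 6 * b 4 + a 7 * b 2,
    a 4 * b 7 + a 5 * b 6 - a 6 * b 5 + a 7 * b 3]

/-- The identity `1 = x_4 + x_5` of the octonion algebra. -/
def octOne [Field F] : Fin 8 → F := ![0, 0, 0, 1, 1, 0, 0, 0]

/-- Octonion conjugation: swaps `x_4, x_5` and negates the other basis vectors. -/
def octConj [Field F] (a : Fin 8 → F) : Fin 8 → F :=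
  ![-a 0, -a 1, -a 2, a 4, a 3, -a 5, -a 6, -a 7]

/-- The trace `Tr(Σ λ_i x_i) = λ_4 + λ_5`. -/
def octTr [Field F] (a : Fin 8 → F) : F := a 3 + a 4

/-- The norm `N(Σ λ_i x_i) = λ_1λ_8 + λ_2λ_7 + λ_3λ_6 + λ_4λ_5`. -/
def octN [Field F] (a : Fin 8 → F) : F :=
  a 0 * a 7 + a 1 * a 6 + a 2 * a 5 + a 3 * a 4

/-- The bilinear form `B(x,y) = N(x+y) − N(x) − N(y)`. -/
def octB [Field F] (a b : Fin 8 → F) : F := octN (a + b) - octN a - octN b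

/-- The basis octonion `x_1`. -/
def octX1 [Field F] : Fin 8 → F := ![1, 0, 0, 0, 0, 0, 0, 0]

/-- Left multiplication by an octonion, as a linear map. -/
def octMulLeft [Field F] (a : Fin 8 → F) : (Fin 8 → F) →ₗ[F] (Fin 8 → F) where
  toFun := octMul a
  map_add' x y := by
    ext i; fin_cases i <;> simp [octMul] <;> ring
  map_smul' c x := by
    ext i; fin_cases i <;> simp [octMul] <;> ring

theorem octMul_octConj_octMul [Field F] (a b : Fin 8 → F) :
    octMul (octConj a) (octMul a b) = octN a • b := by
  ext i; fin_cases i <;> simp [octMul, octConj, octN] <;> ring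

theorem octConj_ne_zero [Field F] {a : Fin 8 → F} (ha : a ≠ 0) : octConj a ≠ 0 := by
  contrapose! ha
  ext i
  have h := fun j => congrFun ha j
  simp only [Fin.forall_fin_succ, octConj] at h
  fin_cases i <;> simp_all

theorem octTr_octMul_octX1_octConj [Field F] (a : Fin 8 → F) :
    octTr (octMul octX1 (octConj a)) = a 7 := by
  simp [octTr, octMul, octX1, octConj]

/-- If four coordinates, selected by `s`, determine the elements of a
submodule of `F ^ 8`, then its dimension is at most four. -/
theorem finrank_le_four_of_coord [Field F] (K : Submodule F (Fin 8 → F)) (s : Fin 4 → Fin 8)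
    (h : ∀ b ∈ K, (∀ j, b (s j) = 0) → b = 0) : Module.finrank F K ≤ 4 := by
  have hinj : Function.Injective ((LinearMap.funLeft F F s).comp K.subtype) := by
    rw [← LinearMap.ker_eq_bot, LinearMap.ker_eq_bot']
    rintro ⟨b, hb⟩ hz
    exact Subtype.ext (h b hb fun j => congrFun hz j)
  simpa using LinearMap.finrank_le_finrank_of_injective hinj

theorem finrank_ker_octMulLeft_le [Field F] {a : Fin 8 → F} (ha : a ≠ 0) :
    Module.finrank F (LinearMap.ker (octMulLeft a)) ≤ 4 := by
  obtain ⟨i, hi⟩ := Function.ne_iff.mp ha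
  refine finrank_le_four_of_coord _
    ((![![0, 1, 2, 3], ![0, 1, 4, 5], ![0, 2, 4, 6], ![1, 2, 4, 7],
      ![0, 3, 5, 6], ![1, 3, 5, 7], ![2, 3, 6, 7], ![4, 5, 6, 7]] : Fin 8 → Fin 4 → Fin 8) i) ?_
  intro b hb hs
  replace hb : octMul a b = 0 := hb
  have hc := fun j => congrFun hb j
  have e0 := hc 0
  have e1 := hc 1
  have e2 := hc 2
  have e3 := hc 3
  have e4 := hc 4
  have e5 := hc 5
  have e6 := hc 6
  have e7 := hc 7
  have s0 := hs 0
  have s1 := hs 1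
  have s2 := hs 2
  have s3 := hs 3
  clear hs hc hb ha
  fin_cases i <;> simp [octMul] at hi s0 s1 s2 s3 e0 e1 e2 e3 e4 e5 e6 e7 <;>
    simp [s0, s1, s2, s3, hi] at e0 e1 e2 e3 e4 e5 e6 e7 <;>
    ext j <;> fin_cases j <;> simp_all

theorem finrank_ker_octMulLeft [Field F] {a : Fin 8 → F} (ha : a ≠ 0) (hN : octN a = 0) :
    Module.finrank F (LinearMap.ker (octMulLeft a)) = 4 := by
  have h₁ := finrank_ker_octMulLeft_le ha
  have h₂ := finrank_ker_octMulLeft_le (octConj_ne_zero ha)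
  have h₃ : LinearMap.range (octMulLeft a) ≤ LinearMap.ker (octMulLeft (octConj a)) := by
    rintro _ ⟨b, rfl⟩
    change octMul (octConj a) (octMul a b) = 0
    rw [octMul_octConj_octMul, hN, zero_smul]
  have h₄ := Submodule.finrank_mono h₃
  have h₅ := LinearMap.finrank_range_add_finrank_ker (octMulLeft a)
  simp only [Module.finrank_fin_fun] at h₅
  lia

theorem octN_eq_zero_of_octMul_eq_zero [Field F] {a b : Fin 8 → F} (hb : b ≠ 0)
    (h : octMul a b = 0) : octN a = 0 := by
  have h' := octMul_octConj_octMul a b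
  have h0 : octMul (octConj a) 0 = 0 := map_zero (octMulLeft (octConj a))
  rw [h, h0] at h'
  exact (smul_eq_zero.mp h'.symm).resolve_right hb

theorem natCard_ne_zero_and_mem {M : Type*} [Zero M] [Finite M] {s : Set M}
    (hs : (0 : M) ∈ s) : Nat.card {x // x ≠ 0 ∧ x ∈ s} = Nat.card s - 1 := by
  rw [Nat.card_coe_set_eq, ← Set.ncard_sdiff_singleton_of_mem hs]
  change Nat.card ({x | x ≠ 0 ∧ x ∈ s} : Set M) = _
  rw [Nat.card_coe_set_eq]
  congr 1
  ext x
  simp [and_comm]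

theorem natCard_nonzero_right_annihilator [Field F] [Fintype F] {a : Fin 8 → F} (ha : a ≠ 0)
    (hN : octN a = 0) :
    Nat.card {b : Fin 8 → F // b ≠ 0 ∧ octMul a b = 0} = Fintype.card F ^ 4 - 1 := by
  have h := natCard_ne_zero_and_mem (s := (LinearMap.ker (octMulLeft a) : Set (Fin 8 → F)))
    (Submodule.zero_mem _)
  have h' := Module.natCard_eq_pow_finrank (K := F) (V := LinearMap.ker (octMulLeft a))
  rw [finrank_ker_octMulLeft ha hN, Nat.card_eq_fintype_card (α := F)] at h'
  rw [← h']
  exact h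

/-- The functional `w ↦ u₀w₁ + u₁w₂ + u₂w₃` on `F ^ 4`. -/
def tailPairing [Field F] (u : Fin 3 → F) : (Fin 4 → F) →ₗ[F] F where
  toFun w := u 0 * w 1 + u 1 * w 2 + u 2 * w 3
  map_add' x y := by simp; ring
  map_smul' c x := by simp; ring

theorem tailPairing_ne_zero [Field F] {u : Fin 3 → F} (hu : u ≠ 0) : tailPairing u ≠ 0 := by
  contrapose! hu
  have h := fun w => LinearMap.congr_fun hu w
  have h0 := h ![0, 1, 0, 0]
  have h1 := h ![0, 0, 1, 0]
  have h2 := h ![0, 0, 0, 1]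
  simp [tailPairing] at h0 h1 h2
  ext i; fin_cases i <;> simp [h0, h1, h2]

theorem natCard_ker_tailPairing [Field F] [Fintype F] {u : Fin 3 → F} (hu : u ≠ 0) :
    Nat.card (LinearMap.ker (tailPairing u)) = Fintype.card F ^ 3 := by
  have h := Module.Dual.finrank_ker_add_one_of_ne_zero (tailPairing_ne_zero hu)
  rw [Module.finrank_fin_fun] at h
  rw [Module.natCard_eq_pow_finrank (K := F), Nat.card_eq_fintype_card,
    show Module.finrank F (LinearMap.ker (tailPairing u)) = 3 by lia]

theorem natCard_ker_tailPairing_zero [Field F] [Fintype F] :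
    Nat.card (LinearMap.ker (tailPairing (0 : Fin 3 → F))) = Fintype.card F ^ 4 := by
  have h : tailPairing (0 : Fin 3 → F) = 0 := by ext; simp [tailPairing]
  rw [h, LinearMap.ker_zero, Module.natCard_eq_pow_finrank (K := F), Nat.card_eq_fintype_card]
  simp

/-- Octonions of norm zero orthogonal to `x_1`, split into the coordinates `2, 3, 4` and a
vector in the kernel of the corresponding functional. -/
def isotropicEquiv [Field F] :
    {a : Fin 8 → F // a 7 = 0 ∧ octN a = 0} ≃
      Σ u : Fin 3 → F, LinearMap.ker (tailPairing u) where
  toFun a := ⟨![a.1 1, a.1 2, a.1 3], ![a.1 0, a.1 6, a.1 5, a.1 4], by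
    have h := a.2.2
    rw [octN, a.2.1] at h
    simpa [tailPairing] using h⟩
  invFun p := ⟨![p.2.1 0, p.1 0, p.1 1, p.1 2, p.2.1 3, p.2.1 2, p.2.1 1, 0], by
    have h : p.1 0 * p.2.1 1 + p.1 1 * p.2.1 2 + p.1 2 * p.2.1 3 = 0 := p.2.2
    simpa [octN] using h⟩
  left_inv a := by
    ext i; fin_cases i <;> simp [a.2.1]
  right_inv := by
    rintro ⟨u, w, hw⟩
    have hu : (![u 0, u 1, u 2] : Fin 3 → F) = u := by ext i; fin_cases i <;> rfl
    have hw' : (![w 0, w 1, w 2, w 3] : Fin 4 → F) = w := by ext i; fin_cases i <;> rfl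
    refine Sigma.ext hu ?_
    refine (Subtype.heq_iff_coe_eq ?_).mpr hw'
    intro x
    change x ∈ LinearMap.ker (tailPairing ![u 0, u 1, u 2]) ↔ _
    rw [hu]

theorem natCard_isotropic [Field F] [Fintype F] :
    Nat.card {a : Fin 8 → F // a 7 = 0 ∧ octN a = 0} =
      Fintype.card F ^ 4 + (Fintype.card F ^ 3 - 1) * Fintype.card F ^ 3 := by
  classical
  rw [Nat.card_congr isotropicEquiv, Nat.card_sigma,
    ← Finset.add_sum_erase _ _ (Finset.mem_univ (0 : Fin 3 → F)), natCard_ker_tailPairing_zero,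
    Finset.sum_congr rfl fun u hu => natCard_ker_tailPairing (Finset.ne_of_mem_erase hu)]
  simp [Finset.card_erase_of_mem]

theorem natCard_nonzero_isotropic [Field F] [Fintype F] :
    Nat.card {a : Fin 8 → F // a ≠ 0 ∧ a 7 = 0 ∧ octN a = 0} =
      Fintype.card F ^ 6 - Fintype.card F ^ 3 + Fintype.card F ^ 4 - 1 := by
  have h := natCard_ne_zero_and_mem (s := {a : Fin 8 → F | a 7 = 0 ∧ octN a = 0})
    (by simp [octN])
  refine h.trans ?_
  refine congrArg (· - 1) (natCard_isotropic.trans ?_)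
  rw [Nat.sub_mul, ← pow_add, one_mul, add_comm]

/-- The pairs being counted, fibred over their first component. -/
def zeroDivisorPairEquiv [Field F] :
    {p : (Fin 8 → F) × (Fin 8 → F) //
        p.1 ≠ 0 ∧ p.2 ≠ 0 ∧ octMul p.1 p.2 = 0 ∧ octTr (octMul octX1 (octConj p.1)) = 0} ≃
      Σ a : {a : Fin 8 → F // a ≠ 0 ∧ a 7 = 0 ∧ octN a = 0},
        {b : Fin 8 → F // b ≠ 0 ∧ octMul a.1 b = 0} where
  toFun p := ⟨⟨p.1.1, p.2.1, (octTr_octMul_octX1_octConj _).symm.trans p.2.2.2.2,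
    octN_eq_zero_of_octMul_eq_zero p.2.2.1 p.2.2.2.1⟩, p.1.2, p.2.2.1, p.2.2.2.1⟩
  invFun s := ⟨(s.1.1, s.2.1), s.1.2.1, s.2.2.1, s.2.2.2,
    (octTr_octMul_octX1_octConj _).trans s.1.2.2.1⟩
  left_inv _ := rfl
  right_inv _ := rfl

/-- The number of pairs `(D, E)` of nonzero octonions with `DE = 0`
and `Tr(x_1·D̄) = 0` equals `(q^6 − q^3 + q^4 − 1)(q^4 − 1)`. -/
theorem stmt_3 {F : Type*} [Field F] [Fintype F] :
    Nat.card {p : (Fin 8 → F) × (Fin 8 → F) //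
        p.1 ≠ 0 ∧ p.2 ≠ 0 ∧ octMul p.1 p.2 = 0 ∧ octTr (octMul octX1 (octConj p.1)) = 0} =
      (Fintype.card F ^ 6 - Fintype.card F ^ 3 + Fintype.card F ^ 4 - 1) *
        (Fintype.card F ^ 4 - 1) := by
  classical
  have := Fintype.ofFinite {a : Fin 8 → F // a ≠ 0 ∧ a 7 = 0 ∧ octN a = 0}
  rw [Nat.card_congr zeroDivisorPairEquiv, Nat.card_sigma,
    Finset.sum_congr rfl fun a _ => natCard_nonzero_right_annihilator a.2.1 a.2.2.2,
    Finset.sum_const, smul_eq_mul, Finset.card_univ, ← Nat.card_eq_fintype_card,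
    natCard_nonzero_isotropic]
end

section
/- Suppose q ≡ 2 (mod 3). Then every white vector v ∈ U satisfies Q(v) = 0; the set M_1 of white points has cardinality (q^4 + 1)(q^{12} − 1)/(q − 1); and M_1 is a (q^4 + 1)-tight set of the elliptic polar space Q^-(25, q) defined by (U, Q): for every singular point P = ⟨u⟩ of U, the number of white points ⟨v⟩ with B_Q(u, v) = 0 equals q^{11} + (q^4 + 1)(q^{11} − 1)/(q − 1) if P is itself a white point, and equals (q^4 + 1)(q^{11} − 1)/(q − 1) otherwise. -/
/-!  The split octonion algebra `O` over a finite field `F` of order `q`,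
represented as `Fin 8 → F` with coordinates with respect to the basis
`x_1, …, x_8` (index `i : Fin 8` corresponds to `x_{i+1}`). -/

variable {F : Type*}

/-- The 27-dimensional space `A = F × F × F × O × O × O`, whose elements encode the
Hermitian matrices `(λ, λ', λ'' | D, E, F)`. -/
abbrev Alb (F : Type*) := F × F × F × (Fin 8 → F) × (Fin 8 → F) × (Fin 8 → F)

/-- `v ∈ U`, i.e. `v` has trace `λ + λ' + λ'' = 0`. -/
def albInU [Field F] (v : Alb F) : Prop := v.1 + v.2.1 + v.2.2.1 = 0

/-- The quadratic form `Q((λ, λ', λ'' | D, E, F)) = λ² + λλ' + λ'² + N(D) + N(E) + N(F)`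
(on `U`). -/
def albQ [Field F] (v : Alb F) : F :=
  v.1 ^ 2 + v.1 * v.2.1 + v.2.1 ^ 2 +
    octN v.2.2.2.1 + octN v.2.2.2.2.1 + octN v.2.2.2.2.2

/-- The polar form `B_Q(u, v) = Q(u + v) − Q(u) − Q(v)`. -/
def albB [Field F] (u v : Alb F) : F := albQ (u + v) - albQ u - albQ v

/-- A vector of `U` is *white* if it has one of the forms (I), (II), (III). -/
def IsWhite [Field F] (v : Alb F) : Prop :=
  (∃ f : F, f ≠ 0 ∧ ∃ A B : Fin 8 → F, octN A + octN B + 1 = 0 ∧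
    v = (f * octN A, f * octN B, f, f • octConj B, f • A, f • octMul (octConj A) B)) ∨
  (∃ e : F, e ≠ 0 ∧ ∃ A C : Fin 8 → F, octN A = 0 ∧ octN C + 1 = 0 ∧
    v = (e * octN C, e, 0, e • A, e • octConj (octMul C A), e • C)) ∨
  (∃ D E G : Fin 8 → F, ¬(D = 0 ∧ E = 0 ∧ G = 0) ∧
    octN D = 0 ∧ octN E = 0 ∧ octN G = 0 ∧
    octMul D E = 0 ∧ octMul E G = 0 ∧ octMul G D = 0 ∧
    v = (0, 0, 0, D, E, G))

/-- The set of white points: the `1`-dimensional subspaces spanned by white vectors. -/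
def whitePoints (F : Type*) [Field F] : Set (Submodule F (Alb F)) :=
  {P | ∃ v : Alb F, IsWhite v ∧ P = Submodule.span F {v}}

section Octonions

variable [Field F]

lemma octB_apply (a b : Fin 8 → F) :
    octB a b = a 0 * b 7 + a 7 * b 0 + (a 1 * b 6 + a 6 * b 1) + (a 2 * b 5 + a 5 * b 2) +
      (a 3 * b 4 + a 4 * b 3) := by
  simp only [octB, octN, Pi.add_apply]; ring

lemma octN_add (a b : Fin 8 → F) : octN (a + b) = octN a + octN b + octB a b := by
  simp only [octB]; ring

lemma octN_smul (r : F) (a : Fin 8 → F) : octN (r • a) = r ^ 2 * octN a := by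
  simp only [octN, Pi.smul_apply, smul_eq_mul]; ring

@[simp] lemma octN_zero : octN (0 : Fin 8 → F) = 0 := by simp [octN]

lemma octN_mul (a b : Fin 8 → F) : octN (octMul a b) = octN a * octN b := by
  simp [octN, octMul]; ring

@[simp] lemma octN_conj (a : Fin 8 → F) : octN (octConj a) = octN a := by
  simp [octN, octConj]; ring

lemma octB_comm (a b : Fin 8 → F) : octB a b = octB b a := by
  simp only [octB_apply]; ring

lemma octB_self (a : Fin 8 → F) : octB a a = 2 * octN a := by
  simp only [octB_apply, octN]; ring

lemma octB_add_right (a b c : Fin 8 → F) : octB a (b + c) = octB a b + octB a c := by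
  simp only [octB_apply, Pi.add_apply]; ring

lemma octB_add_left (a b c : Fin 8 → F) : octB (a + b) c = octB a c + octB b c := by
  simp only [octB_apply, Pi.add_apply]; ring

lemma octB_smul_right (r : F) (a b : Fin 8 → F) : octB a (r • b) = r * octB a b := by
  simp only [octB_apply, Pi.smul_apply, smul_eq_mul]; ring

lemma octB_smul_left (r : F) (a b : Fin 8 → F) : octB (r • a) b = r * octB a b := by
  simp only [octB_apply, Pi.smul_apply, smul_eq_mul]; ring

@[simp] lemma octB_zero_right (a : Fin 8 → F) : octB a 0 = 0 := by simp [octB_apply]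

@[simp] lemma octB_zero_left (a : Fin 8 → F) : octB 0 a = 0 := by simp [octB_apply]

@[simp] lemma octB_conj_conj (a b : Fin 8 → F) : octB (octConj a) (octConj b) = octB a b := by
  simp [octB_apply, octConj]; ring

lemma octB_conj_left (a b : Fin 8 → F) : octB (octConj a) b = octB a (octConj b) := by
  simp [octB_apply, octConj]; ring

lemma exists_octB_eq_one {a : Fin 8 → F} (ha : a ≠ 0) : ∃ b, octB b a = 1 := by
  obtain ⟨i, hi⟩ := Function.ne_iff.mp ha
  refine ⟨Pi.single (Fin.rev i) (a i)⁻¹, ?_⟩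
  rw [Pi.zero_apply] at hi
  fin_cases i <;> simp_all [octB_apply, Fin.rev]

@[simp] lemma octConj_conj (a : Fin 8 → F) : octConj (octConj a) = a := by
  ext i; fin_cases i <;> simp [octConj]

@[simp] lemma octConj_zero : octConj (0 : Fin 8 → F) = 0 := by
  ext i; fin_cases i <;> simp [octConj]

lemma octConj_add (a b : Fin 8 → F) : octConj (a + b) = octConj a + octConj b := by
  ext i; fin_cases i <;> simp [octConj] <;> ring

lemma octConj_smul (r : F) (a : Fin 8 → F) : octConj (r • a) = r • octConj a := by
  ext i; fin_cases i <;> simp [octConj]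

lemma octConj_neg (a : Fin 8 → F) : octConj (-a) = -octConj a := by
  ext i; fin_cases i <;> simp [octConj]

lemma octConj_mul (a b : Fin 8 → F) :
    octConj (octMul a b) = octMul (octConj b) (octConj a) := by
  ext i; fin_cases i <;> simp [octConj, octMul] <;> ring

@[simp] lemma octMul_zero (a : Fin 8 → F) : octMul a 0 = 0 := by
  ext i; fin_cases i <;> simp [octMul]

@[simp] lemma octMul_zero_left (a : Fin 8 → F) : octMul 0 a = 0 := by
  ext i; fin_cases i <;> simp [octMul]

lemma octMul_add (a b c : Fin 8 → F) : octMul a (b + c) = octMul a b + octMul a c := by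
  ext i; fin_cases i <;> simp [octMul] <;> ring

lemma octMul_add_left (a b c : Fin 8 → F) : octMul (a + b) c = octMul a c + octMul b c := by
  ext i; fin_cases i <;> simp [octMul] <;> ring

lemma octMul_smul (r : F) (a b : Fin 8 → F) : octMul a (r • b) = r • octMul a b := by
  ext i; fin_cases i <;> simp [octMul] <;> ring

lemma octMul_smul_left (r : F) (a b : Fin 8 → F) : octMul (r • a) b = r • octMul a b := by
  ext i; fin_cases i <;> simp [octMul] <;> ring

lemma octMul_conj_mul (a b : Fin 8 → F) : octMul a (octMul (octConj a) b) = octN a • b := by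
  ext i; fin_cases i <;> simp [octMul, octConj, octN] <;> ring

lemma octMul_mul_conj_mul (a b c : Fin 8 → F) :
    octMul a (octMul (octConj b) c) + octMul b (octMul (octConj a) c) = octB a b • c := by
  ext i; fin_cases i <;> simp [octMul, octConj, octB_apply] <;> ring

lemma octConj_mul_mul (a b : Fin 8 → F) : octMul (octConj a) (octMul a b) = octN a • b := by
  simpa using octMul_conj_mul (octConj a) b

lemma octMul_conj_mul_right (a b : Fin 8 → F) :
    octMul (octMul b (octConj a)) a = octN a • b := by
  have h := congrArg octConj (octConj_mul_mul a (octConj b))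
  simpa [octConj_mul, octConj_smul] using h

lemma octMul_mul_conj_right (a b : Fin 8 → F) :
    octMul (octMul b a) (octConj a) = octN a • b := by
  simpa using octMul_conj_mul_right (octConj a) b

lemma octMul_conj_mul_add (a b c : Fin 8 → F) :
    octMul (octMul c (octConj a)) b + octMul (octMul c (octConj b)) a = octB a b • c := by
  have h := congrArg octConj (octMul_mul_conj_mul (octConj b) (octConj a) (octConj c))
  simpa [octConj_mul, octConj_smul, octConj_add, octB_comm b a] using h

lemma octB_mul_left_right (a b c : Fin 8 → F) :
    octB (octMul a b) c = octB a (octMul c (octConj b)) := by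
  simp [octB_apply, octMul, octConj]; ring

lemma octB_mul_right_left (a b c : Fin 8 → F) :
    octB (octMul a b) c = octB b (octMul (octConj a) c) := by
  simp [octB_apply, octMul, octConj]; ring

/-- Splitting the coordinates of an octonion into two dual halves. -/
def octSplit : (Fin 8 → F) ≃ (Fin 4 → F) × (Fin 4 → F) where
  toFun a := (![a 0, a 1, a 2, a 3], ![a 7, a 6, a 5, a 4])
  invFun p := ![p.1 0, p.1 1, p.1 2, p.1 3, p.2 3, p.2 2, p.2 1, p.2 0]
  left_inv a := by ext i; fin_cases i <;> rfl
  right_inv p := by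
    ext i <;> fin_cases i <;> rfl

lemma octN_eq_dotProduct (a : Fin 8 → F) : octN a = (octSplit a).1 ⬝ᵥ (octSplit a).2 := by
  simp [octN, octSplit, dotProduct, Fin.sum_univ_four]

end Octonions

section Albert

variable [Field F]

/-- The vanishing of the quadratic adjoint: the equations cutting out the cone over the
`E_6`-variety. -/
def RankLeOne (x : Alb F) : Prop :=
  x.2.1 * x.2.2.1 = octN x.2.2.2.1 ∧ x.1 * x.2.2.1 = octN x.2.2.2.2.1 ∧
    x.1 * x.2.1 = octN x.2.2.2.2.2 ∧
    octMul x.2.2.2.1 x.2.2.2.2.1 = x.2.2.1 • octConj x.2.2.2.2.2 ∧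
    octMul x.2.2.2.2.1 x.2.2.2.2.2 = x.1 • octConj x.2.2.2.1 ∧
    octMul x.2.2.2.2.2 x.2.2.2.1 = x.2.1 • octConj x.2.2.2.2.1

/-- The cubic norm of the Albert algebra. -/
def albDet (x : Alb F) : F :=
  x.1 * x.2.1 * x.2.2.1 - x.1 * octN x.2.2.2.1 - x.2.1 * octN x.2.2.2.2.1 -
    x.2.2.1 * octN x.2.2.2.2.2 + octB (octMul x.2.2.2.1 x.2.2.2.2.1) (octConj x.2.2.2.2.2)

/-- The trace form of the Albert algebra. -/
def albT (c x : Alb F) : F :=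
  c.1 * x.1 + c.2.1 * x.2.1 + c.2.2.1 * x.2.2.1 + octB c.2.2.2.1 x.2.2.2.1 +
    octB c.2.2.2.2.1 x.2.2.2.2.1 + octB c.2.2.2.2.2 x.2.2.2.2.2

/-- Cyclic permutation of the three coordinates. -/
def albRot (x : Alb F) : Alb F :=
  (x.2.1, x.2.2.1, x.1, x.2.2.2.2.1, x.2.2.2.2.2, x.2.2.2.1)

/-- The transposition of the first and third coordinates. -/
def albFlip (x : Alb F) : Alb F :=
  (x.2.2.1, x.2.1, x.1, octConj x.2.2.2.2.2, octConj x.2.2.2.2.1, octConj x.2.2.2.1)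

/-- The elementary transformation adding a multiple of the third coordinate to the first. -/
def albShear (a : Fin 8 → F) (x : Alb F) : Alb F :=
  (x.1 + octB a x.2.2.2.2.1 + octN a * x.2.2.1, x.2.1, x.2.2.1, x.2.2.2.1,
    x.2.2.2.2.1 + x.2.2.1 • a, x.2.2.2.2.2 + octConj (octMul x.2.2.2.1 a))

/-- The elementary transformation adjoint to `albShear a`. -/
def albCoshear (a : Fin 8 → F) (x : Alb F) : Alb F :=
  albFlip (albShear (octConj a) (albFlip x))

lemma albCoshear_apply (a : Fin 8 → F) (l m n : F) (D E G : Fin 8 → F) :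
    albCoshear a (l, m, n, D, E, G) =
      (l, m, n + octB a E + octN a * l, D + octMul (octConj G) (octConj a), E + l • a, G) := by
  simp [albCoshear, albShear, albFlip, octConj_add, octConj_smul]

lemma albFlip_flip (x : Alb F) : albFlip (albFlip x) = x := by simp [albFlip]

lemma albT_comm (c x : Alb F) : albT c x = albT x c := by
  simp only [albT, octB_comm c.2.2.2.1, octB_comm c.2.2.2.2.1, octB_comm c.2.2.2.2.2]; ring

lemma albT_rot (c x : Alb F) : albT (albRot c) (albRot x) = albT c x := by
  simp only [albT, albRot]; ring

lemma albT_flip (c x : Alb F) : albT (albFlip c) (albFlip x) = albT c x := by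
  simp only [albT, albFlip, octB_conj_conj]; ring

lemma albT_shear (a : Fin 8 → F) (c x : Alb F) :
    albT (albShear a c) x = albT c (albCoshear a x) := by
  obtain ⟨l, m, n, D, E, G⟩ := x
  obtain ⟨l', m', n', D', E', G'⟩ := c
  have h : octB (octConj (octMul D' a)) G = octB D' (octMul (octConj G) (octConj a)) := by
    rw [octB_conj_left, octB_mul_left_right]
  simp only [albCoshear_apply, albT, albShear, octB_add_left, octB_add_right, octB_smul_left,
    octB_smul_right, h, octB_comm E' a]
  ring

lemma albShear_neg_shear (a : Fin 8 → F) (x : Alb F) : albShear (-a) (albShear a x) = x := by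
  obtain ⟨l, m, n, D, E, G⟩ := x
  have h1 : octB (-a) E = -octB a E := by rw [← neg_one_smul F a, octB_smul_left]; ring
  have h2 : octB (-a) a = -(2 * octN a) := by
    rw [← neg_one_smul F a, octB_smul_left, octB_self]; ring
  have h3 : octN (-a) = octN a := by rw [← neg_one_smul F a, octN_smul]; ring
  have h4 : octMul D (-a) = -octMul D a := by
    rw [← neg_one_smul F a, octMul_smul, neg_one_smul]
  simp only [albShear, octB_add_right, octB_smul_right, h1, h2, h3, h4, octConj_neg]
  simp
  ring

lemma RankLeOne.rot {x : Alb F} (h : RankLeOne x) : RankLeOne (albRot x) := by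
  obtain ⟨h1, h2, h3, h4, h5, h6⟩ := h
  exact ⟨by simpa [albRot, mul_comm] using h2, by simpa [albRot, mul_comm] using h3,
    by simpa [albRot] using h1, h5, h6, h4⟩

lemma RankLeOne.flip {x : Alb F} (h : RankLeOne x) : RankLeOne (albFlip x) := by
  obtain ⟨h1, h2, h3, h4, h5, h6⟩ := h
  refine ⟨?_, ?_, ?_, ?_, ?_, ?_⟩ <;> simp only [albFlip, octN_conj, ← octConj_mul]
  · rw [← h3, mul_comm]
  · rw [← h2, mul_comm]
  · rw [← h1, mul_comm]
  · rw [h5, octConj_smul]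
  · rw [h4, octConj_smul]
  · rw [h6, octConj_smul]

lemma RankLeOne.shear {x : Alb F} (h : RankLeOne x) (a : Fin 8 → F) :
    RankLeOne (albShear a x) := by
  obtain ⟨l, m, n, D, E, G⟩ := x
  obtain ⟨h1, h2, h3, h4, h5, h6⟩ := h
  simp only at h1 h2 h3 h4 h5 h6
  refine ⟨h1, ?_, ?_, ?_, ?_, ?_⟩ <;> simp only [albShear]
  · rw [octN_add, octN_smul, octB_smul_right, octB_comm E, ← h2]; ring
  · have : octB G (octConj (octMul D a)) = m * octB a E := by
      rw [← octB_conj_left, octB_comm, octB_mul_right_left, ← octConj_mul, h6, octConj_smul,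
        octConj_conj, octB_smul_right]
    rw [octN_add, octN_conj, octN_mul, this, ← h1, ← h3]; ring
  · rw [octMul_add, h4, octMul_smul, octConj_add, octConj_conj, smul_add]
  · have e : octMul a (octConj (octMul D E)) + octMul E (octConj (octMul D a)) =
        octB a E • octConj D := by
      rw [octConj_mul, octConj_mul, octMul_mul_conj_mul]
    rw [h4, octConj_smul, octConj_conj, octMul_smul] at e
    have e2 : octMul a (octConj (octMul D a)) = octN a • octConj D := by
      rw [octConj_mul, octMul_conj_mul]
    rw [octMul_add, octMul_add_left, octMul_add_left, octMul_smul_left, octMul_smul_left, h5, e2,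
      add_smul, add_smul, mul_smul, ← e, smul_comm n]
    abel
  · have e2 : octMul (octConj (octMul D a)) D = octN D • octConj a := by
      rw [octConj_mul, octMul_conj_mul_right]
    rw [octMul_add_left, h6, e2, octConj_add, octConj_smul, smul_add, smul_smul, h1]

lemma RankLeOne.smul {x : Alb F} (h : RankLeOne x) (r : F) : RankLeOne (r • x) := by
  obtain ⟨l, m, n, D, E, G⟩ := x
  obtain ⟨h1, h2, h3, h4, h5, h6⟩ := h
  simp only at h1 h2 h3 h4 h5 h6
  refine ⟨?_, ?_, ?_, ?_, ?_, ?_⟩ <;>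
    simp only [Prod.smul_mk, smul_eq_mul, octN_smul, octMul_smul, octMul_smul_left, octConj_smul,
      h4, h5, h6, smul_smul, ← h1, ← h2, ← h3] <;> ring_nf

lemma rankLeOne_rot_iff {x : Alb F} : RankLeOne (albRot x) ↔ RankLeOne x :=
  ⟨fun h => h.rot.rot, RankLeOne.rot⟩

lemma rankLeOne_flip_iff {x : Alb F} : RankLeOne (albFlip x) ↔ RankLeOne x :=
  ⟨fun h => albFlip_flip x ▸ h.flip, RankLeOne.flip⟩

lemma rankLeOne_shear_iff {a : Fin 8 → F} {x : Alb F} :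
    RankLeOne (albShear a x) ↔ RankLeOne x :=
  ⟨fun h => albShear_neg_shear a x ▸ h.shear (-a), fun h => h.shear a⟩

lemma rankLeOne_coshear_iff {a : Fin 8 → F} {x : Alb F} :
    RankLeOne (albCoshear a x) ↔ RankLeOne x := by
  rw [albCoshear, rankLeOne_flip_iff, rankLeOne_shear_iff, rankLeOne_flip_iff]

lemma albDet_rot (x : Alb F) : albDet (albRot x) = albDet x := by
  obtain ⟨l, m, n, D, E, G⟩ := x
  have h : octB (octMul E G) (octConj D) = octB (octMul D E) (octConj G) := by
    rw [octB_mul_left_right, octB_mul_right_left]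
  simp only [albDet, albRot, h]; ring

lemma albDet_flip (x : Alb F) : albDet (albFlip x) = albDet x := by
  obtain ⟨l, m, n, D, E, G⟩ := x
  have h : octB (octMul (octConj G) (octConj E)) D = octB (octMul D E) (octConj G) := by
    rw [← octConj_mul, octB_conj_left, octB_mul_left_right, octB_mul_right_left]
  simp only [albDet, albFlip, octN_conj, octConj_conj, h]; ring

lemma albDet_shear (a : Fin 8 → F) (x : Alb F) : albDet (albShear a x) = albDet x := by
  obtain ⟨l, m, n, D, E, G⟩ := x
  have h1 : octB (octMul D E) (octMul D a) = octN D * octB E a := by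
    rw [octB_mul_right_left, octConj_mul_mul, octB_smul_right]
  have h2 : octB (octMul D a) (octConj G) = octB G (octConj (octMul D a)) := by
    rw [octB_comm, octB_conj_left]
  simp only [albDet, albShear, octN_add, octN_smul, octN_conj, octN_mul, octMul_add, octMul_smul,
    octConj_add, octConj_conj, octB_add_left, octB_add_right, octB_smul_left, octB_smul_right,
    octB_self, h1, h2, octB_comm E a]
  ring

lemma RankLeOne.albDet_eq_zero {x : Alb F} (h : RankLeOne x) : albDet x = 0 := by
  obtain ⟨l, m, n, D, E, G⟩ := x
  obtain ⟨h1, h2, h3, h4, h5, h6⟩ := h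
  simp only at h1 h2 h3 h4 h5 h6
  simp only [albDet, h4, octB_smul_left, octB_self, octN_conj, ← h1, ← h2, ← h3]
  ring

lemma rankLeOne_of_third (f : F) (A B : Fin 8 → F) :
    RankLeOne (f * octN A, f * octN B, f, f • octConj B, f • A, f • octMul (octConj A) B) := by
  refine ⟨?_, ?_, ?_, ?_, ?_, ?_⟩ <;>
    simp only [octN_smul, octN_conj, octMul_smul, octMul_smul_left, octConj_smul,
      octConj_conj, octN_mul, octConj_mul, octMul_conj_mul, octMul_mul_conj_right] <;>
    first | ring1 | module

lemma rankLeOne_of_second (e : F) {A C : Fin 8 → F} (hA : octN A = 0) :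
    RankLeOne (e * octN C, e, 0, e • A, e • octConj (octMul C A), e • C) := by
  refine ⟨?_, ?_, ?_, ?_, ?_, ?_⟩ <;>
    simp only [octN_smul, octN_conj, octMul_smul, octMul_smul_left, octConj_smul,
      octConj_conj, octN_mul, octConj_mul, octMul_conj_mul, octMul_conj_mul_right, hA] <;>
    first | ring1 | module

lemma rankLeOne_of_first (d : F) {E G : Fin 8 → F} (hE : octN E = 0) (hG : octN G = 0) :
    RankLeOne (d, 0, 0, d • octConj (octMul E G), d • E, d • G) := by
  refine ⟨?_, ?_, ?_, ?_, ?_, ?_⟩ <;>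
    simp only [octN_smul, octN_conj, octMul_smul, octMul_smul_left, octConj_smul,
      octConj_conj, octN_mul, octConj_mul, octMul_conj_mul, octMul_conj_mul_right, hE, hG] <;>
    first | ring1 | module

lemma RankLeOne.eq_of_third_ne_zero {l m n : F} {D E G : Fin 8 → F}
    (h : RankLeOne (l, m, n, D, E, G)) (hn : n ≠ 0) :
    n * octN (n⁻¹ • E) = l ∧ n * octN (n⁻¹ • octConj D) = m ∧
      n • octMul (octConj (n⁻¹ • E)) (n⁻¹ • octConj D) = G := by
  obtain ⟨h1, h2, h3, h4, h5, h6⟩ := h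
  simp only at h1 h2 h3 h4 h5 h6
  refine ⟨?_, ?_, ?_⟩
  · rw [octN_smul, ← h2]; field_simp
  · rw [octN_smul, octN_conj, ← h1]; field_simp
  · rw [octConj_smul, octMul_smul, octMul_smul_left, ← octConj_mul, h4]
    simp [smul_smul, octConj_smul, hn]

lemma RankLeOne.eq_of_second_ne_zero {l m : F} {D E G : Fin 8 → F}
    (h : RankLeOne (l, m, 0, D, E, G)) (hm : m ≠ 0) :
    octN (m⁻¹ • D) = 0 ∧ m * octN (m⁻¹ • G) = l ∧
      m • octConj (octMul (m⁻¹ • G) (m⁻¹ • D)) = E := by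
  obtain ⟨h1, h2, h3, h4, h5, h6⟩ := h
  simp only at h1 h2 h3 h4 h5 h6
  refine ⟨?_, ?_, ?_⟩
  · rw [octN_smul, ← h1]; ring
  · rw [octN_smul, ← h3]; field_simp
  · rw [octMul_smul, octMul_smul_left, h6]
    simp [smul_smul, octConj_smul, hm]

lemma RankLeOne.eq_of_first_ne_zero {l : F} {D E G : Fin 8 → F}
    (h : RankLeOne (l, 0, 0, D, E, G)) (hl : l ≠ 0) :
    octN (l⁻¹ • E) = 0 ∧ octN (l⁻¹ • G) = 0 ∧
      l • octConj (octMul (l⁻¹ • E) (l⁻¹ • G)) = D := by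
  obtain ⟨h1, h2, h3, h4, h5, h6⟩ := h
  simp only at h1 h2 h3 h4 h5 h6
  refine ⟨?_, ?_, ?_⟩
  · rw [octN_smul, ← h2]; ring
  · rw [octN_smul, ← h3]; ring
  · rw [octMul_smul, octMul_smul_left, h5]
    simp [smul_smul, octConj_smul, hl]

lemma rankLeOne_zero_iff {D E G : Fin 8 → F} :
    RankLeOne ((0 : F), (0 : F), (0 : F), D, E, G) ↔
      octN D = 0 ∧ octN E = 0 ∧ octN G = 0 ∧
        octMul D E = 0 ∧ octMul E G = 0 ∧ octMul G D = 0 := by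
  simp [RankLeOne, eq_comm (a := (0 : F))]

lemma isWhite_iff (v : Alb F) : IsWhite v ↔ v ≠ 0 ∧ albInU v ∧ RankLeOne v := by
  constructor
  · rintro (⟨f, hf, A, B, h, rfl⟩ | ⟨e, he, A, C, hA, hC, rfl⟩ | ⟨D, E, G, h0, h, h', h'', h3⟩)
    · refine ⟨by simp [hf], ?_, rankLeOne_of_third f A B⟩
      simp only [albInU]; linear_combination f * h
    · refine ⟨by simp [he], ?_, rankLeOne_of_second e hA⟩
      simp only [albInU]; linear_combination e * hC
    · obtain ⟨h1, h2, h3, rfl⟩ := h3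
      exact ⟨fun h => h0 (by simpa using h), by simp [albInU],
        rankLeOne_zero_iff.2 ⟨h, h', h'', h1, h2, h3⟩⟩
  · obtain ⟨l, m, n, D, E, G⟩ := v
    rintro ⟨h0, ht, h⟩
    simp only [albInU] at ht
    by_cases hn : n = 0
    · subst hn
      by_cases hm : m = 0
      · subst hm
        obtain rfl : l = 0 := by simpa using ht
        obtain ⟨h1, h2, h3, h4, h5, h6⟩ := rankLeOne_zero_iff.1 h
        refine Or.inr (Or.inr ⟨D, E, G, ?_, h1, h2, h3, h4, h5, h6, rfl⟩)
        rintro ⟨rfl, rfl, rfl⟩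
        exact h0 rfl
      · obtain ⟨h1, h2, h3⟩ := h.eq_of_second_ne_zero hm
        refine Or.inr (Or.inl ⟨m, hm, m⁻¹ • D, m⁻¹ • G, h1, ?_, ?_⟩)
        · apply mul_left_cancel₀ hm
          linear_combination h2 + ht
        · rw [h2, h3, smul_inv_smul₀ hm, smul_inv_smul₀ hm]
    · obtain ⟨h1, h2, h3⟩ := h.eq_of_third_ne_zero hn
      refine Or.inl ⟨n, hn, n⁻¹ • E, n⁻¹ • octConj D, ?_, ?_⟩
      · apply mul_left_cancel₀ hn
        linear_combination h1 + h2 + ht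
      · rw [h1, h2, h3, octConj_smul, octConj_conj, smul_inv_smul₀ hn, smul_inv_smul₀ hn]

lemma albB_eq_albT {u v : Alb F} (hu : albInU u) (hv : albInU v) : albB u v = albT u v := by
  simp only [albInU] at hu hv
  simp only [albB, albQ, albT, octB, Prod.fst_add, Prod.snd_add]
  linear_combination (v.1 + v.2.1) * hu - u.2.2.1 * hv

lemma albQ_eq_zero_of_isWhite {v : Alb F} (h : IsWhite v) : albQ v = 0 := by
  obtain ⟨-, ht, h1, h2, h3, -⟩ := (isWhite_iff v).1 h
  simp only [albInU] at ht
  simp only [albQ, ← h1, ← h2, ← h3]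
  linear_combination (v.1 + v.2.1) * ht

end Albert

section Reduction

variable [Field F]

/-- The number of vectors of rank at most one on the hyperplane `c^⊥`. -/
noncomputable def hyperplaneCount (c : Alb F) : ℕ :=
  Nat.card {x : Alb F // RankLeOne x ∧ albT c x = 0}

/-- `albShear` as a permutation. -/
def albShearEquiv (a : Fin 8 → F) : Alb F ≃ Alb F where
  toFun := albShear a
  invFun := albShear (-a)
  left_inv := albShear_neg_shear a
  right_inv x := by simpa using albShear_neg_shear (-a) x

/-- `albFlip` as a permutation. -/
def albFlipEquiv : Alb F ≃ Alb F := ⟨albFlip, albFlip, albFlip_flip, albFlip_flip⟩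

/-- `albRot` as a permutation. -/
def albRotEquiv : Alb F ≃ Alb F := ⟨albRot, fun x => albRot (albRot x), fun _ => rfl, fun _ => rfl⟩

/-- `albCoshear` as a permutation. -/
def albCoshearEquiv (a : Fin 8 → F) : Alb F ≃ Alb F :=
  (albFlipEquiv.trans (albShearEquiv (octConj a))).trans albFlipEquiv

/-- Two vectors agree in the invariants distinguishing the types of hyperplanes. -/
structure SameType (c d : Alb F) : Prop where
  count_eq : hyperplaneCount c = hyperplaneCount d
  det_eq : albDet c = albDet d
  rankLeOne_iff : RankLeOne c ↔ RankLeOne d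
  eq_zero_iff : c = 0 ↔ d = 0

lemma SameType.refl (c : Alb F) : SameType c c := ⟨rfl, rfl, Iff.rfl, Iff.rfl⟩

lemma SameType.trans {c d e : Alb F} (h : SameType c d) (h' : SameType d e) : SameType c e :=
  ⟨h.1.trans h'.1, h.2.trans h'.2, h.3.trans h'.3, h.4.trans h'.4⟩

lemma hyperplaneCount_congr {c d : Alb F} (e : Alb F ≃ Alb F)
    (h : ∀ x, RankLeOne (e x) ↔ RankLeOne x) (h' : ∀ x, albT d (e x) = albT c x) :
    hyperplaneCount c = hyperplaneCount d :=
  Nat.card_congr (e.subtypeEquiv fun x => by rw [h, h'])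

lemma sameType_rot (c : Alb F) : SameType c (albRot c) where
  count_eq := hyperplaneCount_congr albRotEquiv (fun _ => rankLeOne_rot_iff) (albT_rot c)
  det_eq := (albDet_rot c).symm
  rankLeOne_iff := rankLeOne_rot_iff.symm
  eq_zero_iff := (albRotEquiv.apply_eq_iff_eq (x := c) (y := 0)).symm

lemma sameType_flip (c : Alb F) : SameType c (albFlip c) where
  count_eq := hyperplaneCount_congr albFlipEquiv (fun _ => rankLeOne_flip_iff) (albT_flip c)
  det_eq := (albDet_flip c).symm
  rankLeOne_iff := rankLeOne_flip_iff.symm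
  eq_zero_iff := by
    rw [← albFlipEquiv.apply_eq_iff_eq (x := c) (y := 0)]
    simp [albFlipEquiv, albFlip]

lemma sameType_shear (a : Fin 8 → F) (c : Alb F) : SameType c (albShear a c) where
  count_eq := Eq.symm <| hyperplaneCount_congr (albCoshearEquiv a)
    (fun _ => rankLeOne_coshear_iff) fun x => (albT_shear a c x).symm
  det_eq := (albDet_shear a c).symm
  rankLeOne_iff := rankLeOne_shear_iff.symm
  eq_zero_iff := by
    rw [← (albShearEquiv a).apply_eq_iff_eq (x := c) (y := 0)]
    simp [albShearEquiv, albShear]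

lemma sameType_coshear (a : Fin 8 → F) (c : Alb F) : SameType c (albCoshear a c) :=
  ((sameType_flip c).trans (sameType_shear _ _)).trans (sameType_flip _)

/-- The diagonal vectors. -/
def albDiag (l m n : F) : Alb F := (l, m, n, 0, 0, 0)

lemma sameType_diag_of_first_ne_zero {l : F} (m n : F) (hl : l ≠ 0) (G : Fin 8 → F) :
    ∃ l' m' n', SameType (l, m, n, 0, 0, G) (albDiag l' m' n') := by
  have h := (sameType_rot (l, m, n, 0, 0, G)).trans (sameType_shear (-(l⁻¹ • G)) _)
  simp only [albRot, albShear, octMul_zero_left, octConj_zero, smul_neg, smul_smul,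
    mul_inv_cancel₀ hl, one_smul, add_neg_cancel, add_zero] at h
  exact ⟨_, _, _, h⟩

lemma exists_sameType_diag_of_block (l m n : F) (G : Fin 8 → F) :
    ∃ l' m' n', SameType (l, m, n, 0, 0, G) (albDiag l' m' n') := by
  have key : ∀ (l : F) {m : F} (n : F), m ≠ 0 →
      ∃ l' m' n', SameType (l, m, n, 0, 0, G) (albDiag l' m' n') := by
    intro l m n hm
    obtain ⟨l', m', n', h⟩ := sameType_diag_of_first_ne_zero l n hm (octConj G)
    have h1 := (sameType_flip (l, m, n, 0, 0, G)).trans (sameType_rot _)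
    refine ⟨l', m', n', SameType.trans ?_ h⟩
    convert h1 using 1
    simp [albFlip, albRot]
  by_cases hm : m = 0
  · by_cases hG : G = 0
    · subst hG; exact ⟨l, m, n, SameType.refl _⟩
    · obtain ⟨b, hb⟩ := exists_octB_eq_one hG
      by_cases hl : l = 0
      · subst hl hm
        obtain ⟨l', m', n', h⟩ := key 0 n one_ne_zero
        have h1 := ((sameType_rot ((0 : F), (0 : F), n, 0, 0, G)).trans
          (sameType_shear b _)).trans ((sameType_rot _).trans (sameType_rot _))
        refine ⟨l', m', n', SameType.trans ?_ h⟩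
        convert h1 using 1
        simp [albShear, albRot, hb]
      · exact sameType_diag_of_first_ne_zero m n hl G
  · exact key l n hm

lemma exists_sameType_diag_of_third_ne_zero (l m : F) {n : F} (hn : n ≠ 0)
    (D E G : Fin 8 → F) :
    ∃ l' m' n', SameType (l, m, n, D, E, G) (albDiag l' m' n') := by
  have h1 := sameType_shear (-(n⁻¹ • E)) (l, m, n, D, E, G)
  simp only [albShear, smul_neg, smul_smul, mul_inv_cancel₀ hn, one_smul, add_neg_cancel] at h1
  have h2 := (((h1.trans (sameType_rot _)).trans (sameType_rot _)).trans
    (sameType_coshear (-(n⁻¹ • D)) _)).trans (sameType_rot _)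
  simp only [albRot, albCoshear_apply, octConj_zero, octMul_zero_left, smul_neg, smul_smul,
    mul_inv_cancel₀ hn, one_smul, add_neg_cancel, add_zero] at h2
  obtain ⟨l', m', n', h⟩ := exists_sameType_diag_of_block (F := F) _ _ _ _
  exact ⟨l', m', n', h2.trans h⟩

/-- Every vector has the invariants of some diagonal vector. -/
lemma exists_sameType_diag (c : Alb F) : ∃ l m n, SameType c (albDiag l m n) := by
  have key : ∀ l m n : F, ∀ D E G : Fin 8 → F, (n ≠ 0 ∨ E ≠ 0) →
      ∃ l' m' n', SameType (l, m, n, D, E, G) (albDiag l' m' n') := by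
    intro l m n D E G h
    by_cases hn : n = 0
    · obtain ⟨b, hb⟩ := exists_octB_eq_one (h.resolve_left (not_not.2 hn))
      by_cases hl : l = 0
      · have h1 := sameType_coshear b (l, m, n, D, E, G)
        rw [albCoshear_apply, hn, hl, hb, zero_add, mul_zero, add_zero] at h1
        obtain ⟨l', m', n', h2⟩ := exists_sameType_diag_of_third_ne_zero 0 m one_ne_zero
          (D + octMul (octConj G) (octConj b)) (E + (0 : F) • b) G
        rw [hn, hl]
        exact ⟨l', m', n', h1.trans h2⟩
      · have h2 := (sameType_rot (l, m, n, D, E, G))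
        obtain ⟨l', m', n', h3⟩ := exists_sameType_diag_of_third_ne_zero m n hl E G D
        exact ⟨l', m', n', h2.trans h3⟩
    · exact exists_sameType_diag_of_third_ne_zero l m hn D E G
  obtain ⟨l, m, n, D, E, G⟩ := c
  by_cases h1 : n ≠ 0 ∨ E ≠ 0
  · exact key _ _ _ _ _ _ h1
  by_cases h2 : l ≠ 0 ∨ G ≠ 0
  · obtain ⟨l', m', n', h⟩ := key m n l E G D h2
    exact ⟨l', m', n', (sameType_rot _).trans h⟩
  by_cases h3 : m ≠ 0 ∨ D ≠ 0
  · obtain ⟨l', m', n', h⟩ := key n l m G D E h3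
    exact ⟨l', m', n', ((sameType_rot _).trans (sameType_rot _)).trans h⟩
  push Not at h1 h2 h3
  exact ⟨0, 0, 0, by rw [h1.1, h1.2, h2.1, h2.2, h3.1, h3.2]; exact SameType.refl _⟩

lemma rankLeOne_diag_iff {l m n : F} :
    RankLeOne (albDiag l m n) ↔ m * n = 0 ∧ l * n = 0 ∧ l * m = 0 := by
  simp [RankLeOne, albDiag]

lemma albDet_diag (l m n : F) : albDet (albDiag l m n) = l * m * n := by
  simp [albDet, albDiag]

lemma albT_diag (l m n : F) (x : Alb F) :
    albT (albDiag l m n) x = l * x.1 + m * x.2.1 + n * x.2.2.1 := by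
  simp [albT, albDiag]

end Reduction

section Counting

/-- Counting a subtype of a product fibrewise. -/
lemma card_subtype_prod_eq_sum {α β : Type*} [Fintype α] [Finite β] (P : α → β → Prop) :
    Nat.card {x : α × β // P x.1 x.2} = ∑ a, Nat.card {b // P a b} := by
  rw [Nat.card_congr (Equiv.subtypeProdEquivSigmaSubtype P), Nat.card_sigma]

lemma card_subtype_add_card_subtype_not {α : Type*} [Finite α] (P R : α → Prop) :
    Nat.card {x // P x ∧ R x} + Nat.card {x // P x ∧ ¬ R x} = Nat.card {x // P x} := by
  classical
  have := Fintype.ofFinite α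
  simp only [Nat.card_eq_fintype_card, Fintype.card_subtype]
  simp only [← Finset.filter_filter]
  exact Finset.card_filter_add_card_filter_not _

variable [Field F] [Fintype F]

lemma card_fiber_of_surjective {V : Type*} [AddCommGroup V] [Finite V] (f : V →+ F)
    (hf : Function.Surjective f) (s : F) :
    Nat.card {x // f x = s} * Fintype.card F = Nat.card V := by
  classical
  have := Fintype.ofFinite V
  have h : ∀ t, Nat.card {x // f x = t} = Nat.card {x // f x = s} := fun t => by
    simp only [Nat.card_eq_fintype_card, Fintype.card_subtype]
    exact AddMonoidHom.card_fiber_eq_of_mem_range f (hf _) (hf _)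
  rw [← Nat.card_congr (Equiv.sigmaFiberEquiv f), Nat.card_sigma,
    Finset.sum_congr rfl fun t _ => h t]
  simp [mul_comm]

lemma card_octB_eq {a : Fin 8 → F} (ha : a ≠ 0) (s : F) :
    Nat.card {b // octB a b = s} = Fintype.card F ^ 7 := by
  let f : (Fin 8 → F) →+ F := ⟨⟨octB a, by simp⟩, octB_add_right a⟩
  have hf : Function.Surjective f := fun t => by
    obtain ⟨b, hb⟩ := exists_octB_eq_one ha
    exact ⟨t • b, by change octB a (t • b) = t; rw [octB_smul_right, octB_comm, hb, mul_one]⟩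
  have h := card_fiber_of_surjective f hf s
  have h8 : Nat.card (Fin 8 → F) = Fintype.card F ^ 7 * Fintype.card F := by
    simp [Nat.card_eq_fintype_card, pow_succ]
  exact Nat.eq_of_mul_eq_mul_right Fintype.card_pos (h.trans h8)

lemma card_dotProduct_eq {x : Fin 4 → F} (hx : x ≠ 0) (s : F) :
    Nat.card {y : Fin 4 → F // x ⬝ᵥ y = s} = Fintype.card F ^ 3 := by
  classical
  let f : (Fin 4 → F) →+ F := ⟨⟨fun y => x ⬝ᵥ y, by simp⟩, dotProduct_add x⟩
  have hf : Function.Surjective f := fun t => by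
    obtain ⟨i, hi⟩ := Function.ne_iff.mp hx
    exact ⟨Pi.single i ((x i)⁻¹ * t), by
      change x ⬝ᵥ _ = t
      rw [dotProduct_single, mul_inv_cancel_left₀ hi]⟩
  have h := card_fiber_of_surjective f hf s
  have h8 : Nat.card (Fin 4 → F) = Fintype.card F ^ 3 * Fintype.card F := by
    simp [Nat.card_eq_fintype_card, pow_succ]
  exact Nat.eq_of_mul_eq_mul_right Fintype.card_pos (h.trans h8)

open Classical in
lemma card_octN_eq (s : F) :
    Nat.card {a : Fin 8 → F // octN a = s} =
      (Fintype.card F ^ 4 - 1) * Fintype.card F ^ 3 + if s = 0 then Fintype.card F ^ 4 else 0 := by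
  have h := Nat.card_congr (octSplit.subtypeEquiv (p := fun a => octN a = s)
    (q := fun p : (Fin 4 → F) × (Fin 4 → F) => p.1 ⬝ᵥ p.2 = s)
    fun a => by rw [octN_eq_dotProduct])
  rw [h, card_subtype_prod_eq_sum (fun x y : Fin 4 → F => x ⬝ᵥ y = s),
    ← Finset.sum_erase_add _ _ (Finset.mem_univ 0)]
  congr 1
  · rw [Finset.sum_congr rfl fun x hx => card_dotProduct_eq (Finset.ne_of_mem_erase hx) s]
    simp
  · by_cases hs : s = 0
    · simp [hs, Nat.card_eq_fintype_card]
    · simp [hs, Ne.symm hs]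

lemma card_octN_add_octN_eq {r t s : F} (hr : r ≠ 0) (ht : t ≠ 0) (hs : s ≠ 0) :
    Nat.card {p : (Fin 8 → F) × (Fin 8 → F) // r * octN p.1 + t * octN p.2 + s = 0} =
      (Fintype.card F ^ 4 - 1) * Fintype.card F ^ 3 *
        (Fintype.card F ^ 8 + Fintype.card F ^ 4) := by
  classical
  rw [card_subtype_prod_eq_sum (fun x y : Fin 8 → F => r * octN x + t * octN y + s = 0)]
  have h : ∀ x : Fin 8 → F, Nat.card {y : Fin 8 → F // r * octN x + t * octN y + s = 0} =
      (Fintype.card F ^ 4 - 1) * Fintype.card F ^ 3 +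
        if octN x = -(s / r) then Fintype.card F ^ 4 else 0 := by
    intro x
    rw [Nat.card_congr (Equiv.subtypeEquivRight fun y =>
      (show r * octN x + t * octN y + s = 0 ↔ octN y = -(r * octN x + s) / t by
        rw [eq_div_iff ht]; constructor <;> intro h <;> linear_combination h)), card_octN_eq]
    congr 2
    rw [div_eq_zero_iff, or_iff_left ht, neg_eq_zero, ← neg_div, eq_div_iff hr, eq_iff_iff]
    constructor <;> intro h <;> linear_combination h
  rw [Finset.sum_congr rfl fun x _ => h x, Finset.sum_add_distrib, ← Finset.sum_filter]
  have h2 := card_octN_eq (-(s / r))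
  rw [if_neg (by simp [hs, hr]), Nat.card_eq_fintype_card, Fintype.card_subtype] at h2
  simp [h2]
  ring

/-- Right multiplication by an octonion. -/
def octMulRight (D : Fin 8 → F) : (Fin 8 → F) →+ (Fin 8 → F) :=
  ⟨⟨fun G => octMul G D, octMul_zero_left D⟩, fun a b => octMul_add_left a b D⟩

lemma card_ker_octMulRight_conj (D : Fin 8 → F) :
    Nat.card {G // octMul G (octConj D) = 0} = Nat.card {G // octMul G D = 0} := by
  classical
  have key : ∀ D : Fin 8 → F,
      Nat.card {p : (Fin 8 → F) × (Fin 8 → F) // octB (octMul p.1 D) p.2 = 0} +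
        Nat.card {G // octMul G D = 0} * Fintype.card F ^ 7 =
      Nat.card {G // octMul G D = 0} * Fintype.card F ^ 8 + Fintype.card F ^ 15 := by
    intro D
    rw [card_subtype_prod_eq_sum (fun x y => octB (octMul x D) y = 0)]
    have h : ∀ x : Fin 8 → F, Nat.card {y // octB (octMul x D) y = 0} +
        (if octMul x D = 0 then Fintype.card F ^ 7 else 0) =
        Fintype.card F ^ 7 + if octMul x D = 0 then Fintype.card F ^ 8 else 0 := by
      intro x
      split_ifs with hx
      · simp [hx, Nat.card_eq_fintype_card, add_comm]
      · rw [card_octB_eq hx]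
    have h2 := Finset.sum_congr (rfl : (Finset.univ : Finset (Fin 8 → F)) = _) fun x _ => h x
    rw [Finset.sum_add_distrib, Finset.sum_add_distrib, ← Finset.sum_filter,
      ← Finset.sum_filter] at h2
    simp only [Finset.sum_const, Finset.card_univ, Fintype.card_pi, Finset.prod_const,
      Fintype.card_fin, smul_eq_mul] at h2
    rw [Nat.card_eq_fintype_card (α := {G // octMul G D = 0}), Fintype.card_subtype, h2]
    ring
  have h1 := key D
  have h2 := key (octConj D)
  have h3 : Nat.card {p : (Fin 8 → F) × (Fin 8 → F) // octB (octMul p.1 (octConj D)) p.2 = 0} =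
      Nat.card {p : (Fin 8 → F) × (Fin 8 → F) // octB (octMul p.1 D) p.2 = 0} :=
    Nat.card_congr ((Equiv.prodComm _ _).subtypeEquiv fun p => by
      simp only [Equiv.prodComm_apply, Prod.fst_swap, Prod.snd_swap]
      rw [octB_mul_left_right, octConj_conj, octB_comm])
  rw [h3] at h2
  have hq : Fintype.card F ^ 7 < Fintype.card F ^ 8 :=
    Nat.pow_lt_pow_right Fintype.one_lt_card (by norm_num)
  zify at h1 h2 hq ⊢
  have h4 : ((Fintype.card F : ℤ) ^ 8 - (Fintype.card F : ℤ) ^ 7) ≠ 0 := by linarith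
  apply mul_right_cancel₀ h4
  linarith

/-- A nonzero singular octonion has a four-dimensional space of left annihilators. -/
lemma card_left_annihilator {D : Fin 8 → F} (h0 : D ≠ 0) (hD : octN D = 0) :
    Nat.card {G // octMul G D = 0} = Fintype.card F ^ 4 := by
  classical
  have h1 : ∀ y, y ∈ (octMulRight D).range ↔ octMul y (octConj D) = 0 := by
    intro y
    constructor
    · rintro ⟨x, rfl⟩
      change octMul (octMul x D) _ = 0
      rw [octMul_mul_conj_right, hD, zero_smul]
    · intro hy
      obtain ⟨b, hb⟩ := exists_octB_eq_one h0
      refine ⟨octMul y (octConj b), ?_⟩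
      have := octMul_conj_mul_add b D y
      rw [hy, hb, one_smul, octMul_zero_left, add_zero] at this
      exact this
  have h2 : Nat.card (octMulRight D).range * Nat.card (octMulRight D).ker =
      Fintype.card F ^ 8 := by
    rw [← AddSubgroup.index_ker, AddSubgroup.index_mul_card]
    simp [Nat.card_eq_fintype_card]
  rw [Nat.card_congr (Equiv.subtypeEquivRight h1), card_ker_octMulRight_conj] at h2
  have h3 : Nat.card (octMulRight D).ker = Nat.card {G // octMul G D = 0} := rfl
  rw [h3] at h2
  exact Nat.pow_left_injective (n := 2) two_ne_zero (by simp only; rw [sq, h2]; ring)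

end Counting

section RankOneCount

variable [Field F]

/-- The vectors of rank at most one with nonzero third coordinate, on a diagonal hyperplane. -/
def thirdChart (r s t : F) :
    {x : Alb F // (RankLeOne x ∧ albT (albDiag r s t) x = 0) ∧ x.2.2.1 ≠ 0} ≃
      {f : F // f ≠ 0} ×
        {p : (Fin 8 → F) × (Fin 8 → F) // r * octN p.1 + s * octN p.2 + t = 0} where
  toFun x := (⟨x.1.2.2.1, x.2.2⟩,
    ⟨(x.1.2.2.1⁻¹ • x.1.2.2.2.2.1, x.1.2.2.1⁻¹ • octConj x.1.2.2.2.1), by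
      obtain ⟨⟨l, m, n, D, E, G⟩, ⟨h, hT⟩, hn⟩ := x
      obtain ⟨h1, h2, -⟩ := h.eq_of_third_ne_zero hn
      rw [albT_diag] at hT
      simp only at hT hn ⊢
      apply mul_left_cancel₀ hn
      linear_combination r * h1 + s * h2 + hT⟩)
  invFun p := ⟨_, ⟨rankLeOne_of_third p.1.1 p.2.1.1 p.2.1.2, by
    rw [albT_diag]; simp only; linear_combination p.1.1 * p.2.2⟩, p.1.2⟩
  left_inv := by
    rintro ⟨⟨l, m, n, D, E, G⟩, ⟨h, hT⟩, hn⟩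
    obtain ⟨h1, h2, h3⟩ := h.eq_of_third_ne_zero hn
    simp only at hn
    simp only [h1, h2, h3]
    simp only [octConj_smul, octConj_conj, smul_inv_smul₀ hn]
  right_inv := by
    rintro ⟨⟨f, hf⟩, ⟨A, B⟩, h⟩
    simp only [inv_smul_smul₀ hf, octConj_smul, octConj_conj]

/-- The vectors of rank at most one with zero third and nonzero second coordinate, on a diagonal
hyperplane. -/
def secondChart (r s t : F) :
    {x : Alb F // ((RankLeOne x ∧ albT (albDiag r s t) x = 0) ∧ x.2.2.1 = 0) ∧ x.2.1 ≠ 0} ≃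
      {f : F // f ≠ 0} ×
        {A : Fin 8 → F // octN A = 0} × {C : Fin 8 → F // r * octN C + s = 0} where
  toFun x := (⟨x.1.2.1, x.2.2⟩, ⟨x.1.2.1⁻¹ • x.1.2.2.2.1, by
      obtain ⟨⟨l, m, n, D, E, G⟩, ⟨⟨h, hT⟩, hn⟩, hm⟩ := x
      simp only at hn
      subst hn
      exact (h.eq_of_second_ne_zero hm).1⟩,
    ⟨x.1.2.1⁻¹ • x.1.2.2.2.2.2, by
      obtain ⟨⟨l, m, n, D, E, G⟩, ⟨⟨h, hT⟩, hn⟩, hm⟩ := x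
      simp only at hn
      subst hn
      obtain ⟨-, h1, -⟩ := h.eq_of_second_ne_zero hm
      rw [albT_diag] at hT
      simp only at hT hm ⊢
      apply mul_left_cancel₀ hm
      linear_combination r * h1 + hT⟩)
  invFun p := ⟨_, ⟨⟨rankLeOne_of_second (C := p.2.2.1) p.1.1 p.2.1.2, by
    rw [albT_diag]; simp only; linear_combination p.1.1 * p.2.2.2⟩, rfl⟩, p.1.2⟩
  left_inv := by
    rintro ⟨⟨l, m, n, D, E, G⟩, ⟨⟨h, hT⟩, hn⟩, hm⟩
    simp only at hn hm
    subst hn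
    obtain ⟨-, h2, h3⟩ := h.eq_of_second_ne_zero hm
    simp only [h2, h3, smul_inv_smul₀ hm]
  right_inv := by
    rintro ⟨⟨f, hf⟩, ⟨A, hA⟩, ⟨C, hC⟩⟩
    simp only [inv_smul_smul₀ hf]

/-- The vectors of rank at most one for which only the first coordinate does not vanish. -/
def firstChart :
    {x : Alb F // ((RankLeOne x ∧ x.2.2.1 = 0) ∧ x.2.1 = 0) ∧ x.1 ≠ 0} ≃
      {f : F // f ≠ 0} × {E : Fin 8 → F // octN E = 0} × {G : Fin 8 → F // octN G = 0} where
  toFun x := (⟨x.1.1, x.2.2⟩, ⟨x.1.1⁻¹ • x.1.2.2.2.2.1, by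
      obtain ⟨⟨l, m, n, D, E, G⟩, ⟨⟨h, hn⟩, hm⟩, hl⟩ := x
      simp only at hn hm
      subst hn hm
      exact (h.eq_of_first_ne_zero hl).1⟩,
    ⟨x.1.1⁻¹ • x.1.2.2.2.2.2, by
      obtain ⟨⟨l, m, n, D, E, G⟩, ⟨⟨h, hn⟩, hm⟩, hl⟩ := x
      simp only at hn hm
      subst hn hm
      exact (h.eq_of_first_ne_zero hl).2.1⟩)
  invFun p := ⟨_, ⟨⟨rankLeOne_of_first p.1.1 p.2.1.2 p.2.2.2, rfl⟩, rfl⟩, p.1.2⟩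
  left_inv := by
    rintro ⟨⟨l, m, n, D, E, G⟩, ⟨⟨h, hn⟩, hm⟩, hl⟩
    simp only at hn hm hl
    subst hn hm
    obtain ⟨-, -, h3⟩ := h.eq_of_first_ne_zero hl
    simp only [h3, smul_inv_smul₀ hl]
  right_inv := by
    rintro ⟨⟨f, hf⟩, ⟨A, hA⟩, ⟨C, hC⟩⟩
    simp only [inv_smul_smul₀ hf]

open Classical in
/-- An octonion pairing to one with `E`, if there is any. -/
noncomputable def dualVector (E : Fin 8 → F) : Fin 8 → F :=
  if h : E = 0 then 0 else (exists_octB_eq_one h).choose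

lemma octB_dualVector {E : Fin 8 → F} (h : E ≠ 0) : octB (dualVector E) E = 1 := by
  rw [dualVector, dif_neg h]; exact (exists_octB_eq_one h).choose_spec

/-- Triples of singular octonions with vanishing products, the second one being nonzero. -/
noncomputable def offDiagonalChart :
    {x : Alb F // ((((RankLeOne x ∧ x.2.2.1 = 0) ∧ x.2.1 = 0) ∧ x.1 = 0)) ∧ x.2.2.2.2.1 ≠ 0} ≃
      {E : Fin 8 → F // octN E = 0 ∧ E ≠ 0} × {G : Fin 8 → F // octN G = 0} where
  toFun x := (⟨x.1.2.2.2.2.1, by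
      obtain ⟨⟨l, m, n, D, E, G⟩, ⟨⟨⟨h, hn⟩, hm⟩, hl⟩, hE⟩ := x
      simp only at hn hm hl
      subst hn hm hl
      exact ⟨(rankLeOne_zero_iff.1 h).2.1, hE⟩⟩,
    ⟨x.1.2.2.2.2.2 + octConj (octMul x.1.2.2.2.1 (dualVector x.1.2.2.2.2.1)), by
      obtain ⟨⟨l, m, n, D, E, G⟩, ⟨⟨⟨h, hn⟩, hm⟩, hl⟩, hE⟩ := x
      simp only at hn hm hl
      subst hn hm hl
      simpa [albShear] using (h.shear (dualVector E)).2.2.1.symm⟩)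
  invFun p := ⟨albShear (-dualVector p.1.1) (1, 0, 0, octConj (octMul p.1.1 p.2.1), p.1.1, p.2.1),
    ⟨⟨⟨by simpa using (rankLeOne_of_first 1 p.1.2.1 p.2.2).shear (-dualVector p.1.1), rfl⟩, rfl⟩,
      by
        have : octB (-dualVector p.1.1) p.1.1 = -1 := by
          rw [← neg_one_smul F, octB_smul_left, octB_dualVector p.1.2.2, mul_one]
        simp [albShear, this]⟩,
      by simpa [albShear] using p.1.2.2⟩
  left_inv := by
    rintro ⟨⟨l, m, n, D, E, G⟩, ⟨⟨⟨h, hn⟩, hm⟩, hl⟩, hE⟩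
    simp only at hn hm hl hE
    subst hn hm hl
    have h1 := h.shear (dualVector E)
    simp only [albShear, octB_dualVector hE, mul_zero, zero_add, add_zero, zero_smul] at h1
    obtain ⟨-, -, h2⟩ := h1.eq_of_first_ne_zero one_ne_zero
    simp only [inv_one, one_smul] at h2
    apply Subtype.ext
    simp only [h2]
    have h3 := albShear_neg_shear (dualVector E) (0, 0, 0, D, E, G)
    simpa only [albShear, octB_dualVector hE, mul_zero, zero_add, add_zero, zero_smul] using h3
  right_inv := by
    rintro ⟨⟨E, hE, hE0⟩, ⟨G, hG⟩⟩
    have h3 := albShear_neg_shear (-dualVector E) (1, 0, 0, octConj (octMul E G), E, G)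
    simp only [albShear, neg_neg, mul_zero, add_zero, zero_smul, Prod.mk.injEq,
      true_and] at h3
    simp only [albShear, zero_smul, add_zero, h3.2]

/-- Pairs of singular octonions with vanishing product. -/
def degenerateChart :
    {x : Alb F // ((((RankLeOne x ∧ x.2.2.1 = 0) ∧ x.2.1 = 0) ∧ x.1 = 0)) ∧ x.2.2.2.2.1 = 0} ≃
      {p : (Fin 8 → F) × (Fin 8 → F) // octN p.1 = 0 ∧ octN p.2 = 0 ∧ octMul p.2 p.1 = 0} where
  toFun x := ⟨(x.1.2.2.2.1, x.1.2.2.2.2.2), by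
    obtain ⟨⟨l, m, n, D, E, G⟩, ⟨⟨⟨h, hn⟩, hm⟩, hl⟩, hE⟩ := x
    simp only at hn hm hl
    subst hn hm hl
    obtain ⟨h1, -, h2, -, -, h3⟩ := rankLeOne_zero_iff.1 h
    exact ⟨h1, h2, h3⟩⟩
  invFun p := ⟨(0, 0, 0, p.1.1, 0, p.1.2), ⟨⟨⟨rankLeOne_zero_iff.2
    ⟨p.2.1, octN_zero, p.2.2.1, by simp, by simp, p.2.2.2⟩, rfl⟩, rfl⟩, rfl⟩, rfl⟩
  left_inv := by
    rintro ⟨⟨l, m, n, D, E, G⟩, ⟨⟨⟨h, hn⟩, hm⟩, hl⟩, hE⟩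
    simp only at hn hm hl hE
    subst hn hm hl hE
    rfl
  right_inv _ := rfl

variable [Fintype F]

/-- The number of vectors of rank at most one all of whose diagonal coordinates vanish. -/
noncomputable def offDiagonalCount (F : Type*) [Field F] : ℕ :=
  Nat.card {x : Alb F // ((RankLeOne x ∧ x.2.2.1 = 0) ∧ x.2.1 = 0) ∧ x.1 = 0}

/-- The number of singular octonions. -/
noncomputable def singularCount (F : Type*) [Field F] : ℕ :=
  Nat.card {a : Fin 8 → F // octN a = 0}

lemma card_singular_ne_zero :
    Nat.card {a : Fin 8 → F // octN a = 0 ∧ a ≠ 0} + 1 = singularCount F := by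
  rw [singularCount, ← card_subtype_add_card_subtype_not (fun a : Fin 8 → F => octN a = 0)
    (fun a => a = 0), add_comm]
  congr 1
  symm
  rw [Nat.card_eq_one_iff_unique]
  exact ⟨⟨fun a b => Subtype.ext (a.2.2.trans b.2.2.symm)⟩, ⟨⟨0, octN_zero, rfl⟩⟩⟩

lemma card_degenerate :
    Nat.card {p : (Fin 8 → F) × (Fin 8 → F) //
        octN p.1 = 0 ∧ octN p.2 = 0 ∧ octMul p.2 p.1 = 0} =
      singularCount F + (singularCount F - 1) * Fintype.card F ^ 4 := by
  classical
  rw [card_subtype_prod_eq_sum (fun x y : Fin 8 → F => octN x = 0 ∧ octN y = 0 ∧ octMul y x = 0)]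
  have h : ∀ x : Fin 8 → F,
      Nat.card {y : Fin 8 → F // octN x = 0 ∧ octN y = 0 ∧ octMul y x = 0} =
        (if x = 0 then singularCount F else 0) +
          if octN x = 0 ∧ x ≠ 0 then Fintype.card F ^ 4 else 0 := by
    intro x
    by_cases hx : x = 0
    · simp [hx, singularCount]
    by_cases hN : octN x = 0
    · rw [if_neg hx, if_pos ⟨hN, hx⟩, zero_add, ← card_left_annihilator hx hN]
      refine Nat.card_congr (Equiv.subtypeEquivRight fun y =>
        ⟨fun h => h.2.2, fun h => ⟨hN, ?_, h⟩⟩)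
      have := octConj_mul_mul y x
      rw [h, octMul_zero, eq_comm, smul_eq_zero] at this
      exact this.resolve_right hx
    · simp [hx, hN]
  rw [Finset.sum_congr rfl fun x _ => h x, Finset.sum_add_distrib, ← Finset.sum_filter,
    ← Finset.sum_filter, Finset.sum_const, Finset.sum_const, ← Fintype.card_subtype,
    ← Fintype.card_subtype, ← Nat.card_eq_fintype_card, ← Nat.card_eq_fintype_card,
    ← card_singular_ne_zero]
  simp

lemma offDiagonalCount_eq :
    offDiagonalCount F = (singularCount F - 1) * singularCount F +
      (singularCount F + (singularCount F - 1) * Fintype.card F ^ 4) := by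
  rw [offDiagonalCount, ← card_subtype_add_card_subtype_not _ (fun x => x.2.2.2.2.1 = 0), add_comm,
    Nat.card_congr offDiagonalChart, Nat.card_congr degenerateChart, card_degenerate, Nat.card_prod,
    ← card_singular_ne_zero, ← singularCount, Nat.add_sub_cancel, ← card_singular_ne_zero]

lemma card_ne_zero_subtype : Nat.card {f : F // f ≠ 0} = Fintype.card F - 1 := by
  classical
  rw [Nat.card_eq_fintype_card, Fintype.card_subtype_compl]; simp

open Classical in
lemma hyperplaneCount_diag (r s t : F) :
    hyperplaneCount (albDiag r s t) =
      (Fintype.card F - 1) *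
          Nat.card {p : (Fin 8 → F) × (Fin 8 → F) // r * octN p.1 + s * octN p.2 + t = 0} +
        (Fintype.card F - 1) *
          (singularCount F * Nat.card {C : Fin 8 → F // r * octN C + s = 0}) +
        ((if r = 0 then (Fintype.card F - 1) * singularCount F ^ 2 else 0) +
          offDiagonalCount F) := by
  rw [hyperplaneCount, ← card_subtype_add_card_subtype_not _ (fun x => x.2.2.1 = 0), add_comm,
    Nat.card_congr (thirdChart r s t), Nat.card_prod, card_ne_zero_subtype, add_assoc]
  congr 1
  rw [← card_subtype_add_card_subtype_not _ (fun x => x.2.1 = 0), add_comm,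
    Nat.card_congr (secondChart r s t), Nat.card_prod, Nat.card_prod, card_ne_zero_subtype,
    ← singularCount]
  congr 1
  rw [← card_subtype_add_card_subtype_not _ (fun x => x.1 = 0), add_comm]
  congr 1
  · split_ifs with hr
    · rw [← card_ne_zero_subtype, sq, singularCount, ← Nat.card_prod, ← Nat.card_prod,
        ← Nat.card_congr firstChart]
      refine Nat.card_congr (Equiv.subtypeEquivRight fun x => ?_)
      rw [albT_diag, hr]
      constructor
      · rintro ⟨⟨⟨⟨h1, h2⟩, h3⟩, h4⟩, h5⟩
        exact ⟨⟨⟨h1, h3⟩, h4⟩, h5⟩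
      · rintro ⟨⟨⟨h1, h3⟩, h4⟩, h5⟩
        exact ⟨⟨⟨⟨h1, by simp [h3, h4]⟩, h3⟩, h4⟩, h5⟩
    · rw [Nat.card_eq_zero]
      refine Or.inl ⟨?_⟩
      rintro ⟨x, ⟨⟨⟨h1, h2⟩, h3⟩, h4⟩, h5⟩
      rw [albT_diag, h3, h4] at h2
      simp_all
  · refine Nat.card_congr (Equiv.subtypeEquivRight fun x => ?_)
    rw [albT_diag]
    constructor
    · rintro ⟨⟨⟨⟨h1, h2⟩, h3⟩, h4⟩, h5⟩
      exact ⟨⟨⟨h1, h3⟩, h4⟩, h5⟩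
    · rintro ⟨⟨⟨h1, h3⟩, h4⟩, h5⟩
      exact ⟨⟨⟨⟨h1, by simp [h3, h4, h5]⟩, h3⟩, h4⟩, h5⟩

end RankOneCount

section Hyperplanes

variable [Field F] [Fintype F]

lemma singularCount_eq :
    singularCount F = (Fintype.card F ^ 4 - 1) * Fintype.card F ^ 3 + Fintype.card F ^ 4 := by
  classical
  rw [singularCount, card_octN_eq, if_pos rfl]

lemma card_mul_octN_add_eq_zero {r s : F} (hr : r ≠ 0) (hs : s ≠ 0) :
    Nat.card {C : Fin 8 → F // r * octN C + s = 0} =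
      (Fintype.card F ^ 4 - 1) * Fintype.card F ^ 3 := by
  classical
  rw [Nat.card_congr (Equiv.subtypeEquivRight fun C =>
    (show r * octN C + s = 0 ↔ octN C = -s / r by
      rw [eq_div_iff hr]; constructor <;> intro h <;> linear_combination h)), card_octN_eq,
    if_neg (div_ne_zero (neg_ne_zero.2 hs) hr), add_zero]

lemma card_rankLeOne :
    Nat.card {x : Alb F // RankLeOne x} =
      (Fintype.card F - 1) * Fintype.card F ^ 16 +
        (Fintype.card F - 1) * (singularCount F * Fintype.card F ^ 8) +
        ((Fintype.card F - 1) * singularCount F ^ 2 + offDiagonalCount F) := by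
  have h := hyperplaneCount_diag (0 : F) 0 0
  have h0 : hyperplaneCount (albDiag (0 : F) 0 0) = Nat.card {x : Alb F // RankLeOne x} :=
    Nat.card_congr (Equiv.subtypeEquivRight fun x => by simp [albT_diag])
  rw [← h0, h]
  have h8 : Nat.card {C : Fin 8 → F // (0 : F) * octN C + 0 = 0} = Fintype.card F ^ 8 := by
    simp [Nat.card_eq_fintype_card]
  have h16 : Nat.card {p : (Fin 8 → F) × (Fin 8 → F) //
      (0 : F) * octN p.1 + 0 * octN p.2 + 0 = 0} = Fintype.card F ^ 16 := by
    simp [Nat.card_eq_fintype_card]; ring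
  rw [h8, h16, if_pos rfl]

lemma hyperplaneCount_of_rank_one {c : Alb F} (hc : c ≠ 0) (h : RankLeOne c) :
    hyperplaneCount c = (Fintype.card F - 1) * (singularCount F * Fintype.card F ^ 8) +
      ((Fintype.card F - 1) * singularCount F ^ 2 + offDiagonalCount F) := by
  have key : ∀ {t : F}, t ≠ 0 → hyperplaneCount (albDiag 0 0 t) =
      (Fintype.card F - 1) * (singularCount F * Fintype.card F ^ 8) +
      ((Fintype.card F - 1) * singularCount F ^ 2 + offDiagonalCount F) := by
    intro t ht
    have h8 : Nat.card {C : Fin 8 → F // (0 : F) * octN C + 0 = 0} = Fintype.card F ^ 8 := by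
      simp [Nat.card_eq_fintype_card]
    have h16 : Nat.card {p : (Fin 8 → F) × (Fin 8 → F) //
        (0 : F) * octN p.1 + 0 * octN p.2 + t = 0} = 0 := by
      simp [ht]
    rw [hyperplaneCount_diag, h8, h16, if_pos rfl, mul_zero, zero_add]
  obtain ⟨l, m, n, hd⟩ := exists_sameType_diag c
  obtain ⟨h1, h2, h3⟩ := rankLeOne_diag_iff.1 (hd.rankLeOne_iff.1 h)
  rw [ne_eq, hd.eq_zero_iff] at hc
  rw [hd.count_eq]
  by_cases hn : n = 0
  · by_cases hm : m = 0
    · have hl : l ≠ 0 := by rintro rfl; rw [hm, hn] at hc; exact hc rfl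
      rw [hm, hn, (sameType_rot (albDiag l 0 0)).count_eq]
      exact key hl
    · have hl : l = 0 := (mul_eq_zero.1 h3).resolve_right hm
      rw [hl, hn, (sameType_rot (albDiag 0 m 0)).count_eq,
        (sameType_rot (albRot (albDiag 0 m 0))).count_eq]
      exact key hm
  · rw [(mul_eq_zero.1 h1).resolve_right hn, (mul_eq_zero.1 h2).resolve_right hn]
    exact key hn

lemma hyperplaneCount_of_rank_two {c : Alb F} (hdet : albDet c = 0) (h : ¬ RankLeOne c) :
    hyperplaneCount c =
      (Fintype.card F - 1) *
          (Fintype.card F ^ 8 * ((Fintype.card F ^ 4 - 1) * Fintype.card F ^ 3)) +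
        ((Fintype.card F - 1) * singularCount F ^ 2 + offDiagonalCount F) := by
  have key : ∀ {s t : F}, s ≠ 0 → t ≠ 0 → hyperplaneCount (albDiag 0 s t) =
      (Fintype.card F - 1) *
          (Fintype.card F ^ 8 * ((Fintype.card F ^ 4 - 1) * Fintype.card F ^ 3)) +
        ((Fintype.card F - 1) * singularCount F ^ 2 + offDiagonalCount F) := by
    intro s t hs ht
    have h8 : Nat.card {C : Fin 8 → F // (0 : F) * octN C + s = 0} = 0 := by
      simp [hs]
    have h16 : Nat.card {p : (Fin 8 → F) × (Fin 8 → F) //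
        (0 : F) * octN p.1 + s * octN p.2 + t = 0} =
        Fintype.card F ^ 8 * ((Fintype.card F ^ 4 - 1) * Fintype.card F ^ 3) := by
      rw [card_subtype_prod_eq_sum
        (fun x y : Fin 8 → F => (0 : F) * octN x + s * octN y + t = 0)]
      simp only [zero_mul, zero_add, card_mul_octN_add_eq_zero hs ht]
      simp
    rw [hyperplaneCount_diag, h8, h16, if_pos rfl, mul_zero, mul_zero, add_zero]
  obtain ⟨l, m, n, hd⟩ := exists_sameType_diag c
  rw [hd.det_eq, albDet_diag] at hdet
  rw [hd.rankLeOne_iff, rankLeOne_diag_iff] at h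
  rw [hd.count_eq]
  by_cases hl : l = 0
  · subst hl
    refine key ?_ ?_ <;> rintro rfl <;> simp at h
  by_cases hm : m = 0
  · subst hm
    rw [(sameType_rot (albDiag l 0 n)).count_eq]
    refine key ?_ ?_ <;> rintro rfl <;> simp at h hl
  · obtain rfl : n = 0 := by simpa [hl, hm] using hdet
    rw [(sameType_rot (albDiag l m 0)).count_eq, (sameType_rot (albRot (albDiag l m 0))).count_eq]
    exact key hl hm

lemma hyperplaneCount_of_rank_three {c : Alb F} (hdet : albDet c ≠ 0) :
    hyperplaneCount c =
      (Fintype.card F - 1) * ((Fintype.card F ^ 4 - 1) * Fintype.card F ^ 3 *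
          (Fintype.card F ^ 8 + Fintype.card F ^ 4)) +
        (Fintype.card F - 1) *
          (singularCount F * ((Fintype.card F ^ 4 - 1) * Fintype.card F ^ 3)) +
        offDiagonalCount F := by
  obtain ⟨l, m, n, hd⟩ := exists_sameType_diag c
  rw [hd.det_eq, albDet_diag] at hdet
  obtain ⟨⟨hl, hm⟩, hn⟩ : (l ≠ 0 ∧ m ≠ 0) ∧ n ≠ 0 := by simpa [not_or] using hdet
  rw [hd.count_eq, hyperplaneCount_diag, card_octN_add_octN_eq hl hm hn,
    card_mul_octN_add_eq_zero hl hm, if_neg hl, zero_add]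

lemma card_subtype_eq_sum_ite {α : Type*} [Fintype α] (P : α → Prop) [DecidablePred P] :
    Nat.card {x // P x} = ∑ x, if P x then 1 else 0 := by
  rw [Nat.card_eq_fintype_card, Fintype.card_subtype, Finset.card_filter]

/-- Counting along the pencil of hyperplanes spanned by `d^⊥` and `c^⊥`. -/
lemma sum_hyperplaneCount_pencil (c d : Alb F) :
    hyperplaneCount d + ∑ r : F, hyperplaneCount (c + r • d) =
      Nat.card {x : Alb F // RankLeOne x} +
        Fintype.card F * Nat.card {x : Alb F // RankLeOne x ∧ albT d x = 0 ∧ albT c x = 0} := by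
  classical
  have hT : ∀ (r : F) (x : Alb F), albT (c + r • d) x = albT c x + r * albT d x := by
    intro r x
    simp only [albT, Prod.fst_add, Prod.snd_add, Prod.smul_fst, Prod.smul_snd, octB_add_left,
      octB_smul_left, smul_eq_mul]
    ring
  have h1 : ∑ r : F, hyperplaneCount (c + r • d) =
      ∑ x : Alb F, Nat.card {r : F // RankLeOne x ∧ albT (c + r • d) x = 0} := by
    simp only [hyperplaneCount]
    rw [← card_subtype_prod_eq_sum (fun (r : F) x => RankLeOne x ∧ albT (c + r • d) x = 0),
      ← card_subtype_prod_eq_sum (fun x (r : F) => RankLeOne x ∧ albT (c + r • d) x = 0)]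
    exact Nat.card_congr ((Equiv.prodComm _ _).subtypeEquiv fun p => Iff.rfl)
  rw [h1, hyperplaneCount, card_subtype_eq_sum_ite, card_subtype_eq_sum_ite,
    card_subtype_eq_sum_ite, Finset.mul_sum, ← Finset.sum_add_distrib, ← Finset.sum_add_distrib]
  refine Finset.sum_congr rfl fun x _ => ?_
  simp only [hT]
  by_cases hx : RankLeOne x
  · by_cases hd : albT d x = 0
    · by_cases hc : albT c x = 0
      · simp [hx, hd, hc, Nat.card_eq_fintype_card]
      · simp [hx, hd, hc]
    · have : Nat.card {r : F // albT c x + r * albT d x = 0} = 1 := by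
        rw [Nat.card_eq_one_iff_unique]
        refine ⟨⟨fun a b => Subtype.ext (mul_right_cancel₀ hd ?_)⟩,
          ⟨⟨-albT c x / albT d x, by field_simp; ring⟩⟩⟩
        linear_combination a.2 - b.2
      simpa [hx, hd, Nat.card_eq_fintype_card] using this
  · simp [hx]

/-- Counting the points spanned by a scale-invariant set of nonzero vectors. -/
lemma ncard_points_mul {V : Type*} [AddCommGroup V] [Module F V] [Finite V] (P : V → Prop)
    (h0 : ∀ v, P v → v ≠ 0) (hP : ∀ v (r : F), r ≠ 0 → P v → P (r • v)) :
    {S : Submodule F V | ∃ v, P v ∧ S = Submodule.span F {v}}.ncard * (Fintype.card F - 1) =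
      Nat.card {v // P v} := by
  classical
  have := Fintype.ofFinite V
  set T := {S : Submodule F V | ∃ v, P v ∧ S = Submodule.span F {v}} with hT
  have : Finite T := by
    have : T = Set.range fun v : {v // P v} => Submodule.span F {v.1} := by
      ext S; simp [hT, eq_comm]
    rw [this]; infer_instance
  have := Fintype.ofFinite T
  let f : {v // P v} → T := fun v => ⟨Submodule.span F {v.1}, v.1, v.2, rfl⟩
  rw [← Nat.card_congr (Equiv.sigmaFiberEquiv f), Nat.card_sigma,
    Finset.sum_congr rfl fun S _ => (?_ : Nat.card {v // f v = S} = Fintype.card F - 1)]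
  · rw [Finset.sum_const, smul_eq_mul, Finset.card_univ, ← Nat.card_coe_set_eq T,
      Nat.card_eq_fintype_card (α := T)]
  · obtain ⟨-, v, hv, rfl⟩ := S
    rw [← Fintype.card_units, ← Nat.card_eq_fintype_card]
    symm
    refine Nat.card_eq_of_bijective (fun r : Fˣ => ⟨⟨(r : F) • v, hP v r r.ne_zero hv⟩, ?_⟩)
      ⟨?_, ?_⟩
    · exact Subtype.ext
        (Submodule.span_singleton_eq_span_singleton.2 ⟨r⁻¹, by simp [Units.smul_def]⟩)
    · intro r s hrs
      simp only [Subtype.mk.injEq] at hrs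
      exact Units.ext (smul_left_injective F (h0 v hv) hrs)
    · rintro ⟨⟨w, hw⟩, hfw⟩
      obtain ⟨r, hr⟩ := Submodule.span_singleton_eq_span_singleton.1 (congrArg Subtype.val hfw).symm
      exact ⟨r, Subtype.ext (Subtype.ext hr)⟩

end Hyperplanes

section CubicPencil

variable [Field F]

lemma albDet_add_smul_one {u : Alb F} (hu : albInU u) (hQ : albQ u = 0) (r : F) :
    albDet (u + r • albDiag 1 1 1) = r ^ 3 + albDet u := by
  obtain ⟨l, m, n, D, E, G⟩ := u
  simp only [albInU, albQ] at hu hQ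
  simp only [albDet, albDiag, Prod.smul_mk, Prod.mk_add_mk, smul_eq_mul, mul_one, smul_zero,
    add_zero]
  linear_combination (r ^ 2 + r * (l + m)) * hu - r * hQ

lemma eq_zero_of_rankLeOne_add_smul_one (h3 : (3 : F) ≠ 0) {u : Alb F} (hu : albInU u)
    (hQ : albQ u = 0) {r : F} (h : RankLeOne (u + r • albDiag 1 1 1)) : r = 0 := by
  obtain ⟨l, m, n, D, E, G⟩ := u
  obtain ⟨h1, h2, h4, -⟩ := h
  simp only [albInU, albQ] at hu hQ
  simp only [albDiag, Prod.smul_mk, Prod.mk_add_mk, smul_eq_mul, mul_one, smul_zero,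
    add_zero] at h1 h2 h4
  have : 3 * r ^ 2 = 0 := by
    linear_combination h1 + h2 + h4 + hQ - (2 * r + l + m) * hu
  simpa [h3] using this

variable [Fintype F]

lemma three_ne_zero_of_card (hq : Fintype.card F % 3 = 2) : (3 : F) ≠ 0 := by
  intro h
  have h1 := FiniteField.cast_card_eq_zero F
  rw [← Nat.div_add_mod (Fintype.card F) 3, hq] at h1
  push_cast at h1
  exact one_ne_zero (α := F) (by linear_combination (1 + (↑(Fintype.card F / 3) : F)) * h - h1)

lemma cube_injective (hq : Fintype.card F % 3 = 2) :
    Function.Injective fun x : F => x ^ 3 := by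
  refine Function.LeftInverse.injective (g := fun x => x ^ (2 * (Fintype.card F / 3) + 1))
    fun x => ?_
  have h : 3 * (2 * (Fintype.card F / 3) + 1) = Fintype.card F + (Fintype.card F - 1) := by omega
  have h1 : Fintype.card F = (Fintype.card F - 1) + 1 := by omega
  change (x ^ 3) ^ _ = x
  rw [← pow_mul, h, pow_add, FiniteField.pow_card, ← pow_succ', ← h1, FiniteField.pow_card]

/-- Exactly one member of the pencil spanned by a singular vector and the identity has zero
determinant. -/
lemma exists_albDet_pencil_eq_zero_iff (hq : Fintype.card F % 3 = 2) {u : Alb F} (hu : albInU u)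
    (hQ : albQ u = 0) : ∃ s : F, ∀ r, albDet (u + r • albDiag 1 1 1) = 0 ↔ r = s := by
  obtain ⟨s, hs⟩ := (Finite.injective_iff_surjective.1 (cube_injective hq)) (-albDet u)
  refine ⟨s, fun r => ?_⟩
  simp only at hs
  rw [albDet_add_smul_one hu hQ, add_eq_zero_iff_eq_neg, ← hs]
  exact (cube_injective hq).eq_iff

end CubicPencil

section WhitePoints

variable [Field F]

lemma albDiag_one_ne_zero_det : albDet (albDiag (1 : F) 1 1) ≠ 0 := by
  simp [albDet_diag]

lemma albInU_iff_albT_one {v : Alb F} : albInU v ↔ albT (albDiag 1 1 1) v = 0 := by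
  simp [albInU, albT_diag]

lemma rankLeOne_zero : RankLeOne (0 : Alb F) :=
  rankLeOne_diag_iff.2 ⟨mul_zero 0, mul_zero 0, mul_zero 0⟩

lemma albT_smul_right (c x : Alb F) (r : F) : albT c (r • x) = r * albT c x := by
  rw [albT_comm, albT_comm c x]
  simp only [albT, Prod.smul_fst, Prod.smul_snd, octB_smul_left, smul_eq_mul]
  ring

lemma isWhite_smul {v : Alb F} (h : IsWhite v) {r : F} (hr : r ≠ 0) : IsWhite (r • v) := by
  rw [isWhite_iff, albInU_iff_albT_one] at h ⊢
  exact ⟨smul_ne_zero hr h.1, by rw [albT_smul_right, h.2.1, mul_zero], h.2.2.smul r⟩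

lemma span_mem_whitePoints_iff {u : Alb F} (h0 : u ≠ 0) (hu : albInU u) :
    Submodule.span F {u} ∈ whitePoints F ↔ RankLeOne u := by
  constructor
  · rintro ⟨v, hv, hs⟩
    obtain ⟨r, rfl⟩ := Submodule.span_singleton_eq_span_singleton.1 hs.symm
    exact ((isWhite_iff v).1 hv).2.2.smul _
  · exact fun h => ⟨u, (isWhite_iff u).2 ⟨h0, hu, h⟩, rfl⟩

variable [Fintype F]

lemma card_nonzero_add_one {V : Type*} [AddCommGroup V] [Finite V] (P : V → Prop) (h0 : P 0) :
    Nat.card {v // v ≠ 0 ∧ P v} + 1 = Nat.card {v // P v} := by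
  classical
  change Set.ncard {v | v ≠ 0 ∧ P v} + 1 = Set.ncard {v | P v}
  rw [← Set.ncard_sdiff_singleton_add_one (s := {v | P v}) (a := 0) h0]
  congr 2
  ext v
  simp [and_comm]

lemma card_isWhite_add_one :
    Nat.card {v : Alb F // IsWhite v} + 1 = hyperplaneCount (albDiag (1 : F) 1 1) := by
  rw [hyperplaneCount, ← card_nonzero_add_one
    (fun x : Alb F => RankLeOne x ∧ albT (albDiag 1 1 1) x = 0)
    ⟨rankLeOne_zero, by simp [albT_diag]⟩]
  congr 1
  refine Nat.card_congr (Equiv.subtypeEquivRight fun v => ?_)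
  rw [isWhite_iff, albInU_iff_albT_one, and_comm (a := RankLeOne v)]

lemma card_isWhite_orthogonal_add_one {u : Alb F} (hu : albInU u) :
    Nat.card {v : Alb F // IsWhite v ∧ albB u v = 0} + 1 =
      Nat.card {x : Alb F // RankLeOne x ∧ albT (albDiag 1 1 1) x = 0 ∧ albT u x = 0} := by
  rw [← card_nonzero_add_one
    (fun x : Alb F => RankLeOne x ∧ albT (albDiag 1 1 1) x = 0 ∧ albT u x = 0)
    ⟨rankLeOne_zero, by simp [albT_diag], by
      rw [← zero_smul F (0 : Alb F), albT_smul_right, zero_mul]⟩]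
  congr 1
  refine Nat.card_congr (Equiv.subtypeEquivRight fun v => ?_)
  rw [isWhite_iff, ← albInU_iff_albT_one]
  constructor
  · rintro ⟨⟨h0, hv, h⟩, hB⟩
    exact ⟨h0, h, hv, by rwa [← albB_eq_albT hu hv]⟩
  · rintro ⟨h0, h, hv, hT⟩
    exact ⟨⟨h0, hv, h⟩, by rwa [albB_eq_albT hu hv]⟩

lemma card_isWhite :
    Nat.card {v : Alb F // IsWhite v} =
      (Fintype.card F ^ 4 + 1) * (Fintype.card F ^ 12 - 1) := by
  have h := card_isWhite_add_one (F := F)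
  rw [hyperplaneCount_of_rank_three albDiag_one_ne_zero_det, offDiagonalCount_eq,
    singularCount_eq] at h
  have hq := Fintype.one_lt_card (α := F)
  generalize Fintype.card F = q at h hq ⊢
  have hp : ∀ k, 1 ≤ q ^ k := fun k => Nat.one_le_pow _ _ (by omega)
  have h7 : 1 ≤ (q ^ 4 - 1) * q ^ 3 + q ^ 4 := le_add_left (hp 4)
  zify [hp, h7, hq.le] at h ⊢
  linear_combination h

lemma sum_hyperplaneCount_eq {c : Alb F} {s : F}
    (hs : ∀ r, albDet (c + r • albDiag 1 1 1) = 0 ↔ r = s) :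
    ∑ r : F, hyperplaneCount (c + r • albDiag 1 1 1) =
      (Fintype.card F - 1) * hyperplaneCount (albDiag (1 : F) 1 1) +
        hyperplaneCount (c + s • albDiag 1 1 1) := by
  classical
  rw [← Finset.sum_erase_add _ _ (Finset.mem_univ s), Finset.sum_congr rfl fun r hr =>
    (?_ : _ = hyperplaneCount (albDiag (1 : F) 1 1)), Finset.sum_const,
    Finset.card_erase_of_mem (Finset.mem_univ s), Finset.card_univ, smul_eq_mul]
  rw [hyperplaneCount_of_rank_three albDiag_one_ne_zero_det,
    hyperplaneCount_of_rank_three fun h => Finset.ne_of_mem_erase hr ((hs r).1 h)]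

lemma card_isWhite_orthogonal_of_rankLeOne (hq : Fintype.card F % 3 = 2) {u : Alb F}
    (h0 : u ≠ 0) (hu : albInU u) (hQ : albQ u = 0) (h : RankLeOne u) :
    Nat.card {v : Alb F // IsWhite v ∧ albB u v = 0} =
      Fintype.card F ^ 11 * (Fintype.card F - 1) +
        (Fintype.card F ^ 4 + 1) * (Fintype.card F ^ 11 - 1) := by
  obtain ⟨s, hs⟩ := exists_albDet_pencil_eq_zero_iff hq hu hQ
  obtain rfl : 0 = s := (hs 0).1 (by rw [zero_smul, add_zero]; exact h.albDet_eq_zero)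
  have key := sum_hyperplaneCount_pencil u (albDiag 1 1 1)
  rw [sum_hyperplaneCount_eq hs, zero_smul, add_zero, hyperplaneCount_of_rank_one h0 h,
    ← card_isWhite_add_one, card_isWhite, ← card_isWhite_orthogonal_add_one hu, card_rankLeOne,
    offDiagonalCount_eq, singularCount_eq] at key
  have hq1 := Fintype.one_lt_card (α := F)
  generalize Nat.card {v : Alb F // IsWhite v ∧ albB u v = 0} = N at key ⊢
  generalize Fintype.card F = q at key hq1 ⊢
  have hp : ∀ k, 1 ≤ q ^ k := fun k => Nat.one_le_pow _ _ (by omega)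
  have h7 : 1 ≤ (q ^ 4 - 1) * q ^ 3 + q ^ 4 := le_add_left (hp 4)
  have hz : (q : ℤ) ≠ 0 := by positivity
  zify [hp, h7, hq1.le] at key ⊢
  apply mul_left_cancel₀ hz
  linear_combination -key

lemma card_isWhite_orthogonal_of_not_rankLeOne (hq : Fintype.card F % 3 = 2) {u : Alb F}
    (hu : albInU u) (hQ : albQ u = 0) (h : ¬ RankLeOne u) :
    Nat.card {v : Alb F // IsWhite v ∧ albB u v = 0} =
      (Fintype.card F ^ 4 + 1) * (Fintype.card F ^ 11 - 1) := by
  obtain ⟨s, hs⟩ := exists_albDet_pencil_eq_zero_iff hq hu hQ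
  have hr : ¬ RankLeOne (u + s • albDiag 1 1 1) := fun hr => by
    obtain rfl := eq_zero_of_rankLeOne_add_smul_one (three_ne_zero_of_card hq) hu hQ hr
    rw [zero_smul, add_zero] at hr
    exact h hr
  have key := sum_hyperplaneCount_pencil u (albDiag 1 1 1)
  rw [sum_hyperplaneCount_eq hs, hyperplaneCount_of_rank_two ((hs s).2 rfl) hr,
    ← card_isWhite_add_one, card_isWhite, ← card_isWhite_orthogonal_add_one hu, card_rankLeOne,
    offDiagonalCount_eq, singularCount_eq] at key
  have hq1 := Fintype.one_lt_card (α := F)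
  generalize Nat.card {v : Alb F // IsWhite v ∧ albB u v = 0} = N at key ⊢
  generalize Fintype.card F = q at key hq1 ⊢
  have hp : ∀ k, 1 ≤ q ^ k := fun k => Nat.one_le_pow _ _ (by omega)
  have h7 : 1 ≤ (q ^ 4 - 1) * q ^ 3 + q ^ 4 := le_add_left (hp 4)
  have hz : (q : ℤ) ≠ 0 := by positivity
  zify [hp, h7, hq1.le] at key ⊢
  apply mul_left_cancel₀ hz
  linear_combination -key

lemma ncard_whitePoints :
    (whitePoints F).ncard =
      (Fintype.card F ^ 4 + 1) * (Fintype.card F ^ 12 - 1) / (Fintype.card F - 1) := by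
  have hq := Fintype.one_lt_card (α := F)
  refine Nat.eq_div_of_mul_eq_left (by omega) ?_
  rw [← card_isWhite]
  exact ncard_points_mul _ (fun v hv => ((isWhite_iff v).1 hv).1)
    fun v r hr hv => isWhite_smul hv hr

lemma ncard_whitePoints_orthogonal_mul {u : Alb F} (hu : albInU u) :
    {P : Submodule F (Alb F) |
        ∃ v : Alb F, IsWhite v ∧ albB u v = 0 ∧ P = Submodule.span F {v}}.ncard *
      (Fintype.card F - 1) = Nat.card {v : Alb F // IsWhite v ∧ albB u v = 0} := by
  simp only [← and_assoc]
  refine ncard_points_mul _ (fun v hv => ((isWhite_iff v).1 hv.1).1) ?_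
  rintro v r hr ⟨hv, hB⟩
  have hU := ((isWhite_iff v).1 hv).2.1
  have hw := isWhite_smul hv hr
  rw [albB_eq_albT hu hU] at hB
  exact ⟨hw, by rw [albB_eq_albT hu ((isWhite_iff _).1 hw).2.1, albT_smul_right, hB, mul_zero]⟩

end WhitePoints

open scoped Classical

/-- Suppose `q ≡ 2 (mod 3)`.  Every white vector `v ∈ U` satisfies
`Q(v) = 0`; the set `M_1` of white points has cardinality
`(q^4 + 1)(q^{12} − 1)/(q − 1)`; and `M_1` is a `(q^4+1)`-tight set of the elliptic
polar space `Q⁻(25, q)` defined by `(U, Q)`: for every singular point `P = ⟨u⟩` of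
`U`, the number of white points `⟨v⟩` with `B_Q(u, v) = 0` equals
`q^{11} + (q^4 + 1)(q^{11} − 1)/(q − 1)` if `P` is itself a white point, and
`(q^4 + 1)(q^{11} − 1)/(q − 1)` otherwise. -/
theorem stmt_6 {F : Type*} [Field F] [Fintype F] (hq : Fintype.card F % 3 = 2) :
    (∀ v : Alb F, IsWhite v → albQ v = 0) ∧
    (whitePoints F).ncard =
      (Fintype.card F ^ 4 + 1) * (Fintype.card F ^ 12 - 1) / (Fintype.card F - 1) ∧
    ∀ u : Alb F, u ≠ 0 → albInU u → albQ u = 0 →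
      {P : Submodule F (Alb F) |
          ∃ v : Alb F, IsWhite v ∧ albB u v = 0 ∧ P = Submodule.span F {v}}.ncard =
        if Submodule.span F {u} ∈ whitePoints F then
          Fintype.card F ^ 11 +
            (Fintype.card F ^ 4 + 1) * (Fintype.card F ^ 11 - 1) / (Fintype.card F - 1)
        else
          (Fintype.card F ^ 4 + 1) * (Fintype.card F ^ 11 - 1) / (Fintype.card F - 1) := by
  refine ⟨fun _ => albQ_eq_zero_of_isWhite, ncard_whitePoints, fun u h0 hu hQ => ?_⟩
  have hq1 : 0 < Fintype.card F - 1 := Nat.sub_pos_of_lt Fintype.one_lt_card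
  have hmul := ncard_whitePoints_orthogonal_mul hu
  split_ifs with h <;> rw [span_mem_whitePoints_iff h0 hu] at h
  · rw [card_isWhite_orthogonal_of_rankLeOne hq h0 hu hQ h] at hmul
    rw [Nat.eq_div_of_mul_eq_left hq1.ne' hmul, Nat.add_comm, Nat.add_mul_div_right _ _ hq1,
      Nat.add_comm]
  · rw [card_isWhite_orthogonal_of_not_rankLeOne hq hu hQ h] at hmul
    exact Nat.eq_div_of_mul_eq_left hq1.ne' hmul
end
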